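/- arXiv:1404.1197 — 3 statements merged into one kernel-verified Lean document; each statement's English description precedes it below -/
import Mathlib

section
/- Let s ∈ (0,1) and let φ(t) = (t_+)^s for t ∈ ℝ. Then the one-dimensional fractional Laplacian (−Δ)^s φ vanishes on (0,∞): for every x > 0, PV ∫_ℝ ( φ(x+r) + φ(x−r) − 2φ(x) ) |r|^{-1-2s} dr = 0. -/
open MeasureTheory
open Filter Topology Set

noncomputable def hh (s t : ℝ) : ℝ := ((1+t)^s - 1) / t^(1+2*s)
noncomputable def qq (s r : ℝ) : ℝ := ((max (1+r) 0)^s + (max (1-r) 0)^s - 2) / |r|^(1+2*s)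

lemma hh_cont (s : ℝ) : ContinuousOn (hh s) (Ioi 0) := by
  intro t ht
  have ht : 0 < t := ht
  apply ContinuousAt.continuousWithinAt
  unfold hh
  refine ContinuousAt.div ?_ ?_ (by positivity)
  · exact ((continuousAt_const.add continuousAt_id).rpow_const (Or.inl (by simp; positivity))).sub continuousAt_const
  · exact continuousAt_id.rpow_const (Or.inl ht.ne')

lemma hh_bound0 {s t : ℝ} (hs0 : 0 < s) (hs1 : s < 1) (ht : 0 < t) : ‖hh s t‖ ≤ t ^ (-2*s) := by
  unfold hh
  have h1 : (1:ℝ) ≤ (1+t)^s := Real.one_le_rpow (by linarith) hs0.le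
  have h2 : (1+t)^s ≤ 1 + s * t := rpow_one_add_le_one_add_mul_self (by linarith) hs0.le hs1.le
  rw [Real.norm_of_nonneg (div_nonneg (by linarith) (by positivity)), div_le_iff₀ (by positivity),
    ← Real.rpow_add ht]
  ring_nf
  rw [Real.rpow_one]
  nlinarith

lemma hh_bound1 {s t : ℝ} (hs0 : 0 < s) (hs1 : s < 1) (ht : 1 ≤ t) : ‖hh s t‖ ≤ 2 * t ^ (-1-s) := by
  have ht0 : 0 < t := by linarith
  unfold hh
  have h1 : (1:ℝ) ≤ (1+t)^s := Real.one_le_rpow (by linarith) hs0.le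
  have h2 : (1+t)^s ≤ 2 * t^s := by
    calc (1+t)^s ≤ (2*t)^s := Real.rpow_le_rpow (by linarith) (by linarith) hs0.le
      _ = 2^s * t^s := Real.mul_rpow (by norm_num) ht0.le
      _ ≤ 2 * t^s := by
        gcongr
        calc (2:ℝ)^s ≤ 2^(1:ℝ) := Real.rpow_le_rpow_of_exponent_le (by norm_num) hs1.le
          _ = 2 := Real.rpow_one 2
  rw [Real.norm_of_nonneg (div_nonneg (by linarith) (by positivity)), div_le_iff₀ (by positivity),
    mul_assoc, ← Real.rpow_add ht0]
  ring_nf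
  linarith

lemma hh_int {s : ℝ} (hs0 : 0 < s) (hs1 : s < 1) : IntegrableOn (hh s) (Ioi 1) := by
  refine Integrable.mono' (g := fun t => 2 * t ^ (-1-s)) ?_ ?_ ?_
  · exact (integrableOn_Ioi_rpow_of_lt (by linarith) one_pos).const_mul 2
  · exact ((hh_cont s).mono (Ioi_subset_Ioi zero_le_one)).aestronglyMeasurable measurableSet_Ioi
  · filter_upwards [ae_restrict_mem measurableSet_Ioi] with t ht
    exact hh_bound1 hs0 hs1 (le_of_lt ht)

lemma qq_meas (s : ℝ) : Measurable (qq s) := by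
  unfold qq; fun_prop

lemma qq_Ioi1 {s r : ℝ} (hs0 : 0 < s) (hr : 1 < r) : qq s r = hh s r - r^(-1-2*s) := by
  unfold qq hh
  rw [abs_of_pos (by linarith), max_eq_left (by linarith), max_eq_right (by linarith),
    Real.zero_rpow hs0.ne', show -1-2*s = -(1+2*s) by ring, Real.rpow_neg (by linarith)]
  field_simp
  ring

lemma qq_Ioc {s r : ℝ} (hr0 : 0 < r) (hr : r ≤ 1) :
    qq s r = ((1+r)^s + (1-r)^s - 2) / r^(1+2*s) := by
  unfold qq
  rw [abs_of_pos hr0, max_eq_left (by linarith), max_eq_left (by linarith)]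

lemma qq_int1 {s : ℝ} (hs0 : 0 < s) (hs1 : s < 1) : IntegrableOn (qq s) (Ioi 1) := by
  refine IntegrableOn.congr_fun (f := fun r => hh s r - r^(-1-2*s)) ?_ ?_ measurableSet_Ioi
  · exact (hh_int hs0 hs1).sub (integrableOn_Ioi_rpow_of_lt (by linarith) one_pos)
  · intro r hr
    exact (qq_Ioi1 hs0 hr).symm

lemma bern {s y : ℝ} (hs0 : 0 < s) (hs1 : s < 1) (hy : -1 ≤ y) (hy2 : y ≤ 1) :
    (1+y) / (1 + (1-s)*y) ≤ (1+y)^s := by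
  rcases eq_or_lt_of_le hy with h | h
  · rw [← h]; simp; positivity
  have h0 : 0 < 1 + y := by linarith
  have h3 : (1+y)^(1-s) ≤ 1 + (1-s) * y :=
    rpow_one_add_le_one_add_mul_self hy (by linarith) (by linarith)
  have h4 : 0 < (1+y)^(1-s) := by positivity
  rw [div_le_iff₀ (by linarith)]
  calc 1 + y = (1+y)^s * (1+y)^(1-s) := by rw [← Real.rpow_add h0]; simp
    _ ≤ _ := by gcongr

lemma qq_bound {s r : ℝ} (hs0 : 0 < s) (hs1 : s < 1) (hr0 : 0 < r) (hr : r ≤ 1) :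
    ‖qq s r‖ ≤ 2 * r^(1-2*s) := by
  rw [qq_Ioc hr0 hr]
  have a1 : (1+r)^s ≤ 1 + s * r :=
    rpow_one_add_le_one_add_mul_self (by linarith) hs0.le hs1.le
  have a2 : (1-r)^s ≤ 1 - s * r := by
    have := rpow_one_add_le_one_add_mul_self (s := -r) (by linarith) hs0.le hs1.le
    simpa [sub_eq_add_neg] using this
  have b1 := bern hs0 hs1 (y := r) (by linarith) hr
  have b2 := bern hs0 hs1 (y := -r) (by linarith) (by linarith)
  rw [← sub_eq_add_neg] at b2
  have key : 2 - 2*r^2 ≤ (1+r) / (1 + (1-s)*r) + (1-r) / (1 + (1-s)*(-r)) := by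
    have p1 : 0 < 1 + (1-s)*r := by nlinarith
    have p2 : 0 < 1 + (1-s)*(-r) := by nlinarith
    rw [div_add_div _ _ p1.ne' p2.ne', le_div_iff₀ (by positivity)]
    have e : (1 + r) * (1 + (1 - s) * -r) + (1 + (1 - s) * r) * (1 - r)
      - (2 - 2 * r ^ 2) * ((1 + (1 - s) * r) * (1 + (1 - s) * -r)) =
      2*r^2*(s + (1-s)^2 * (1 - r^2)) := by ring
    have : 0 ≤ 1 - r^2 := by nlinarith
    have : 0 ≤ 2*r^2*(s + (1-s)^2 * (1 - r^2)) := by positivity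
    linarith
  rw [norm_div, Real.norm_of_nonneg (show 0 ≤ r^(1+2*s) by positivity), div_le_iff₀ (by positivity),
    mul_assoc, ← Real.rpow_add hr0, show 1 - 2*s + (1+2*s) = (2:ℕ) by push_cast; ring,
    Real.rpow_natCast, Real.norm_eq_abs, abs_le]
  constructor <;> nlinarith

lemma qq_int0 {s : ℝ} (hs0 : 0 < s) (hs1 : s < 1) : IntegrableOn (qq s) (Ioc 0 1) := by
  refine Integrable.mono' (g := fun t => 2 * t ^ (1-2*s)) ?_ (qq_meas s).aestronglyMeasurable ?_
  · have := (intervalIntegral.intervalIntegrable_rpow' (a := 0) (b := 1) (r := 1-2*s) (by linarith)).const_mul 2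
    exact (intervalIntegrable_iff_integrableOn_Ioc_of_le zero_le_one).1 this
  · filter_upwards [ae_restrict_mem measurableSet_Ioc] with t ht
    exact qq_bound hs0 hs1 ht.1 ht.2

noncomputable def PP (s r : ℝ) : ℝ := ∫ t in (1:ℝ)..r, hh s t

lemma hh_ii {s a b : ℝ} (ha : 0 < a) (hb : 0 < b) : IntervalIntegrable (hh s) volume a b := by
  apply ContinuousOn.intervalIntegrable
  apply (hh_cont s).mono
  intro t ht
  exact lt_of_lt_of_le (lt_min ha hb) ht.1

lemma PP_deriv {s r : ℝ} (hr : 0 < r) : HasDerivAt (PP s) (hh s r) r :=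
  intervalIntegral.integral_hasDerivAt_right (hh_ii one_pos hr)
    ((hh_cont s).stronglyMeasurableAtFilter isOpen_Ioi r hr)
    ((hh_cont s).continuousAt (Ioi_mem_nhds hr))

noncomputable def Phi (s r : ℝ) : ℝ :=
  (1 - (1-r)^s)^2 * r^(-2*s) / (2*s) - PP s (r/(1-r)) + PP s r

lemma Phi_deriv {s r : ℝ} (hs0 : 0 < s) (hr0 : 0 < r) (hr : r < 1) :
    HasDerivAt (Phi s) (qq s r) r := by
  have h1 : 0 < 1 - r := by linarith
  have d1 : HasDerivAt (fun r : ℝ => 1 - r) (-1) r := by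
    simpa using (hasDerivAt_id r).const_sub 1
  have d2 := d1.rpow_const (p := s) (Or.inl h1.ne')
  have d3 := (d2.const_sub 1).pow 2
  have d4 := (hasDerivAt_id r).rpow_const (p := -2*s) (Or.inl hr0.ne')
  have d5 := (hasDerivAt_id r).div d1 h1.ne'
  have d6 := (PP_deriv (s := s) (r := r/(1-r)) (by positivity)).comp r d5
  have d7 := (((d3.mul d4).div_const (2*s)).sub d6).add (PP_deriv (s := s) hr0)
  refine HasDerivAt.congr_deriv (f' := _) (by exact d7) ?_
  rw [qq_Ioc hr0 hr.le]
  have e1 : 1 + r/(1-r) = (1-r)⁻¹ := by field_simp; ring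
  simp only [hh, e1, id]
  rw [Real.inv_rpow h1.le, Real.div_rpow hr0.le h1.le, Real.rpow_sub h1, Real.rpow_add h1,
    show 2*s = s + s by ring, Real.rpow_add h1, Real.rpow_one, Real.rpow_add hr0,
    show -2*s = -(s+s) by ring, Real.rpow_sub hr0, Real.rpow_neg hr0.le, Real.rpow_add hr0,
    Real.rpow_one]
  have hu : 0 < (1-r)^s := by positivity
  have hv : 0 < r^s := by positivity
  set u := (1-r)^s
  set v := r^s
  set w := (1+r)^s
  simp
  field_simp
  ring

lemma Phi_one {s : ℝ} (hs0 : 0 < s) (hs1 : s < 1) :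
    Tendsto (Phi s) (𝓝[<] 1) (𝓝 (1/(2*s) - ∫ t in Ioi 1, hh s t)) := by
  have t1 : Tendsto (fun r : ℝ => (1 - (1-r)^s)^2 * r^(-2*s) / (2*s)) (𝓝[<] 1) (𝓝 (1/(2*s))) := by
    have : ContinuousAt (fun r : ℝ => (1 - (1-r)^s)^2 * r^(-2*s) / (2*s)) 1 := by
      refine ContinuousAt.div_const (ContinuousAt.mul (ContinuousAt.pow (ContinuousAt.sub
        continuousAt_const (ContinuousAt.rpow_const (by fun_prop) (Or.inr hs0.le))) 2) ?_) _
      exact continuousAt_id.rpow_const (Or.inl one_ne_zero)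
    have h := this.tendsto.mono_left (nhdsWithin_le_nhds (s := Iio 1))
    simpa [Real.zero_rpow hs0.ne'] using h
  have t2 : Tendsto (fun r : ℝ => r / (1-r)) (𝓝[<] 1) atTop := by
    have a : Tendsto (fun r : ℝ => 1 - r) (𝓝[<] 1) (𝓝[>] 0) := by
      refine tendsto_nhdsWithin_iff.2 ⟨?_, ?_⟩
      · have : ContinuousAt (fun r : ℝ => 1 - r) 1 := by fun_prop
        simpa using this.tendsto.mono_left (nhdsWithin_le_nhds (s := Iio 1))
      · filter_upwards [self_mem_nhdsWithin] with r hr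
        simpa using hr
    have b := a.inv_tendsto_nhdsGT_zero
    have c : Tendsto (fun r : ℝ => r) (𝓝[<] 1) (𝓝 1) := tendsto_id.mono_left nhdsWithin_le_nhds
    exact c.pos_mul_atTop one_pos b
  have t3 := intervalIntegral_tendsto_integral_Ioi 1 (hh_int hs0 hs1) t2
  have t4 : Tendsto (PP s) (𝓝[<] 1) (𝓝 0) := by
    have := (PP_deriv (s := s) one_pos).continuousAt.tendsto.mono_left (nhdsWithin_le_nhds (s := Iio 1))
    simpa [PP] using this
  have := (t1.sub t3).add t4
  rw [add_zero] at this
  exact this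

lemma Phi_zero {s : ℝ} (hs0 : 0 < s) (hs1 : s < 1) :
    Tendsto (Phi s) (𝓝[>] 0) (𝓝 0) := by
  have t0 : Tendsto (fun r : ℝ => (1/(2*s) + 2) * r^(2-2*s)) (𝓝[>] 0) (𝓝 0) := by
    have : ContinuousAt (fun r : ℝ => (1/(2*s) + 2) * r^(2-2*s)) 0 :=
      continuousAt_const.mul (continuousAt_id.rpow_const (Or.inr (by linarith)))
    have h := this.tendsto.mono_left (nhdsWithin_le_nhds (s := Ioi 0))
    simpa [Real.zero_rpow (show 2-2*s ≠ 0 by linarith)] using h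
  refine squeeze_zero_norm' ?_ t0
  filter_upwards [Ioo_mem_nhdsGT (show (0:ℝ) < 1/2 by norm_num)] with r hr
  obtain ⟨hr0, hr1⟩ := hr
  have h1 : 0 < 1 - r := by linarith
  have hq : 0 < r / (1-r) := by positivity
  have e : PP s (r/(1-r)) - PP s r = ∫ t in r..(r/(1-r)), hh s t :=
    intervalIntegral.integral_interval_sub_left (hh_ii one_pos hq) (hh_ii one_pos hr0)
  have hle : r ≤ r/(1-r) := by rw [le_div_iff₀ h1]; nlinarith
  have bd : ‖∫ t in r..(r/(1-r)), hh s t‖ ≤ r^(-2*s) * |r/(1-r) - r| := by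
    apply intervalIntegral.norm_integral_le_of_norm_le_const
    intro t ht
    rw [uIoc_of_le hle] at ht
    refine (hh_bound0 hs0 hs1 (hr0.trans ht.1)).trans ?_
    exact Real.rpow_le_rpow_of_nonpos hr0 ht.1.le (by linarith)
  have len : |r/(1-r) - r| ≤ 2*r^2 := by
    rw [abs_of_nonneg (by linarith), sub_le_iff_le_add, div_le_iff₀ h1]
    nlinarith [sq_nonneg r, mul_pos hr0 hr0]
  have hR : r^(2-2*s) = r^(-2*s) * r^2 := by
    rw [show 2-2*s = -2*s + (2:ℕ) by push_cast; ring, Real.rpow_add hr0, Real.rpow_natCast]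
  have hp : 0 < r^(-2*s) := by positivity
  have u1 : (1-r)^s ≤ 1 := Real.rpow_le_one h1.le (by linarith) hs0.le
  have u2 : 1 - r ≤ (1-r)^s := by
    simpa using Real.rpow_le_rpow_of_exponent_ge h1 (by linarith) hs1.le
  have hsq : (1 - (1-r)^s)^2 ≤ r^2 := by apply pow_le_pow_left₀ <;> linarith
  have eP : Phi s r = (1 - (1-r)^s)^2 * r^(-2*s) / (2*s) - ∫ t in r..(r/(1-r)), hh s t := by
    rw [← e]; unfold Phi; ring
  rw [eP, hR]
  refine (norm_sub_le _ _).trans ?_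
  rw [Real.norm_of_nonneg (by positivity), add_mul]
  apply add_le_add
  · calc (1 - (1-r)^s)^2 * r^(-2*s) / (2*s) ≤ r^2 * r^(-2*s) / (2*s) := by gcongr
      _ = _ := by ring
  · refine bd.trans ?_
    calc r^(-2*s) * |r/(1-r) - r| ≤ r^(-2*s) * (2*r^2) := by gcongr
      _ = _ := by ring

lemma qq_integral {s : ℝ} (hs0 : 0 < s) (hs1 : s < 1) : ∫ r in Ioi 0, qq s r = 0 := by
  have a : ∫ r in (0:ℝ)..1, qq s r = (1/(2*s) - ∫ t in Ioi 1, hh s t) - 0 :=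
    intervalIntegral.integral_eq_sub_of_hasDerivAt_of_tendsto zero_lt_one
      (fun r hr => Phi_deriv hs0 hr.1 hr.2)
      ((intervalIntegrable_iff_integrableOn_Ioc_of_le zero_le_one).2 (qq_int0 hs0 hs1))
      (Phi_zero hs0 hs1) (Phi_one hs0 hs1)
  rw [intervalIntegral.integral_of_le zero_le_one] at a
  have b : ∫ r in Ioi 1, qq s r = (∫ t in Ioi 1, hh s t) - 1/(2*s) := by
    rw [setIntegral_congr_fun measurableSet_Ioi (fun r hr => qq_Ioi1 hs0 hr),
      integral_sub (hh_int hs0 hs1) (integrableOn_Ioi_rpow_of_lt (by linarith) one_pos),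
      integral_Ioi_rpow_of_lt (by linarith) one_pos, Real.one_rpow,
      show -1 - 2*s + 1 = -(2*s) by ring, neg_div_neg_eq]
  rw [← Ioc_union_Ioi_eq_Ioi (zero_le_one (α := ℝ)), setIntegral_union
    (Ioc_disjoint_Ioi le_rfl) measurableSet_Ioi (qq_int0 hs0 hs1) (qq_int1 hs0 hs1), a, b]
  ring

lemma qq_even (s r : ℝ) : qq s (-r) = qq s r := by
  unfold qq
  rw [abs_neg, sub_neg_eq_add, ← sub_eq_add_neg, add_comm ((max (1-r) 0)^s)]

lemma qq_abs (s r : ℝ) : qq s |r| = qq s r := by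
  rcases abs_choice r with h | h <;> rw [h]
  exact qq_even s r

lemma qq_all {s : ℝ} (hs0 : 0 < s) (hs1 : s < 1) : Integrable (qq s) ∧ ∫ r, qq s r = 0 := by
  constructor
  · have a : IntegrableOn (qq s) (Ioi 0) := by
      rw [← Ioc_union_Ioi_eq_Ioi (zero_le_one (α := ℝ))]
      exact (qq_int0 hs0 hs1).union (qq_int1 hs0 hs1)
    have b : IntegrableOn (qq s) (Iic 0) := by
      have a' : IntegrableOn (qq s) (Ici (-(0:ℝ))) := by
        rw [neg_zero]
        exact Iff.mpr integrableOn_Ici_iff_integrableOn_Ioi a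
      have := a'.comp_neg_Iic
      simpa [qq_even] using this
    rw [← integrableOn_univ, ← Iic_union_Ioi (a := (0:ℝ))]
    exact b.union a
  · have := integral_comp_abs (f := qq s)
    simp only [qq_abs] at this
    rw [this, qq_integral hs0 hs1, mul_zero]

theorem stmt3 (s : ℝ) (hs0 : 0 < s) (hs1 : s < 1) (x : ℝ) (hx : 0 < x) :
    Integrable (fun r : ℝ =>
        ((max (x + r) 0) ^ s + (max (x - r) 0) ^ s - 2 * (max x 0) ^ s) / |r| ^ (1 + 2 * s)) ∧
      ∫ r : ℝ,
        ((max (x + r) 0) ^ s + (max (x - r) 0) ^ s - 2 * (max x 0) ^ s) / |r| ^ (1 + 2 * s)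
        = 0 := by
  have e : (fun r : ℝ =>
        ((max (x + r) 0) ^ s + (max (x - r) 0) ^ s - 2 * (max x 0) ^ s) / |r| ^ (1 + 2 * s)) =
      fun r => (x^s / x^(1+2*s)) * qq s (x⁻¹ * r) := by
    funext r
    have m : ∀ y : ℝ, (max (x*y) 0)^s = x^s * (max y 0)^s := by
      intro y
      rw [← Real.mul_rpow hx.le (le_max_right _ _), mul_max_of_nonneg _ _ hx.le, mul_zero]
    have e1 : x + r = x * (1 + x⁻¹*r) := by field_simp
    have e2 : x - r = x * (1 - x⁻¹*r) := by field_simp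
    have e3 : |r| = x * |x⁻¹*r| := by
      rw [abs_mul, abs_of_pos (inv_pos.2 hx)]; field_simp
    rw [max_eq_left hx.le, e1, e2, e3, m, m, Real.mul_rpow hx.le (abs_nonneg _)]
    unfold qq
    rw [div_mul_div_comm]
    congr 1
    ring
  obtain ⟨h1, h2⟩ := qq_all hs0 hs1
  rw [e]
  refine ⟨(h1.comp_mul_left' (inv_ne_zero hx.ne')).const_mul _, ?_⟩
  rw [integral_const_mul, Measure.integral_comp_mul_left, h2]
  simp
end

section
/- There exists a scale-invariant family of kernels in the class L_0 for which the half-space power solutions are not comparable to d^s. Concretely: let s ∈ (0,1), 0 < λ < Λ, and let L be the operator with kernel K(y) = (1-s)(λ + (Λ−λ)·1_{B_{1/2}}(y)) |y|^{-n-2s}. Then for u(x) = ((x_n)_+)^s and any point x = (x', 1) with x_n = 1, one has Lu(x) < 0. -/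
open MeasureTheory Metric

open Set Filter Topology

lemma aux_T_int (s : ℝ) (hs0 : 0 < s) (c : ℝ) (hc : 0 < c) :
    IntegrableOn (fun t : ℝ => t ^ (-1 - 2 * s)) (Ioi c) :=
  integrableOn_Ioi_rpow_of_lt (by linarith) hc

lemma aux_P_int (s : ℝ) (hs0 : 0 < s) (c : ℝ) (hc : 0 < c) :
    IntegrableOn (fun t : ℝ => (max (1 - t) 0) ^ s * t ^ (-1 - 2 * s)) (Ioi c) := by
  refine Integrable.mono' (aux_T_int s hs0 c hc) ?_ ?_
  · apply Measurable.aestronglyMeasurable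
    fun_prop
  · filter_upwards [ae_restrict_mem measurableSet_Ioi] with t ht
    have ht0 : 0 < t := hc.trans ht
    have h1 : 0 ≤ (max (1 - t) 0) ^ s := by positivity
    have h2 : (max (1 - t) 0) ^ s ≤ 1 :=
      Real.rpow_le_one (le_max_right _ _) (max_le (by linarith) zero_le_one) hs0.le
    have h3 : 0 ≤ t ^ (-1 - 2 * s) := by positivity
    rw [Real.norm_of_nonneg (by positivity)]
    nlinarith

lemma aux_R_int (s : ℝ) (hs0 : 0 < s) (hs1 : s < 1) (c : ℝ) (hc : 0 < c) :
    IntegrableOn (fun t : ℝ => (1 + t) ^ (s - 1) * t ^ (-1 - 2 * s)) (Ioi c) := by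
  refine Integrable.mono' (aux_T_int s hs0 c hc) ?_ ?_
  · apply Measurable.aestronglyMeasurable
    fun_prop
  · filter_upwards [ae_restrict_mem measurableSet_Ioi] with t ht
    have ht0 : 0 < t := hc.trans ht
    have h2 : (1 + t) ^ (s - 1) ≤ 1 :=
      Real.rpow_le_one_of_one_le_of_nonpos (by linarith) (by linarith)
    have h3 : 0 ≤ t ^ (-1 - 2 * s) := by positivity
    rw [Real.norm_of_nonneg (by positivity)]
    nlinarith

lemma aux_rpow_step (t p : ℝ) (ht : 0 < t) : t ^ p = t ^ (p - 1) * t := by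
  rw [Real.rpow_sub_one ht.ne']; field_simp

lemma aux_deriv (s t : ℝ) (ht : 0 < t) :
    HasDerivAt (fun t : ℝ => (1 + t) ^ s * t ^ (-2 * s))
      (-s * ((1 + t) ^ s * t ^ (-1 - 2 * s) + (1 + t) ^ (s - 1) * t ^ (-1 - 2 * s))) t := by
  have h1 : HasDerivAt (fun t : ℝ => (1 + t) ^ s) (1 * s * (1 + t) ^ (s - 1)) t :=
    ((hasDerivAt_id t).const_add 1).rpow_const (Or.inl (by simp; positivity))
  have h2 : HasDerivAt (fun t : ℝ => t ^ (-2 * s)) (1 * (-2 * s) * t ^ (-2 * s - 1)) t :=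
    (hasDerivAt_id t).rpow_const (Or.inl (by simp; positivity))
  refine (h1.mul h2).congr_deriv ?_
  rw [aux_rpow_step (1 + t) s (by positivity), aux_rpow_step t (-2 * s) ht,
    show -1 - 2 * s = -2 * s - 1 by ring]
  ring

lemma aux_tendsto (s : ℝ) (hs0 : 0 < s) :
    Tendsto (fun t : ℝ => (1 + t) ^ s * t ^ (-2 * s)) atTop (𝓝 0) := by
  have h : Tendsto (fun t : ℝ => 2 ^ s * t ^ (-s)) atTop (𝓝 (2 ^ s * 0)) :=
    (tendsto_rpow_neg_atTop hs0).const_mul _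
  rw [mul_zero] at h
  refine tendsto_of_tendsto_of_tendsto_of_le_of_le' tendsto_const_nhds h ?_ ?_
  · filter_upwards [eventually_ge_atTop 1] with t ht
    positivity
  · filter_upwards [eventually_ge_atTop 1] with t ht
    have ht0 : 0 < t := by linarith
    have : (1 + t) ^ s ≤ (2 * t) ^ s := Real.rpow_le_rpow (by positivity) (by linarith) hs0.le
    rw [Real.mul_rpow (by norm_num) ht0.le] at this
    calc (1 + t) ^ s * t ^ (-2 * s) ≤ (2 ^ s * t ^ s) * t ^ (-2 * s) := by gcongr
      _ = 2 ^ s * t ^ (-s) := by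
        rw [mul_assoc, ← Real.rpow_add ht0]; congr 2; ring

lemma aux_QR (s : ℝ) (hs0 : 0 < s) (e : ℝ) (he : 0 < e) :
    IntegrableOn (fun t : ℝ => (1 + t) ^ s * t ^ (-1 - 2 * s)
      + (1 + t) ^ (s - 1) * t ^ (-1 - 2 * s)) (Ioi e) ∧
    ∫ t in Ioi e, ((1 + t) ^ s * t ^ (-1 - 2 * s) + (1 + t) ^ (s - 1) * t ^ (-1 - 2 * s))
      = (1 + e) ^ s * e ^ (-2 * s) / s := by
  have hd : ∀ x ∈ Ici e, HasDerivAt (fun t : ℝ => (1 + t) ^ s * t ^ (-2 * s))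
      (-s * ((1 + x) ^ s * x ^ (-1 - 2 * s) + (1 + x) ^ (s - 1) * x ^ (-1 - 2 * s))) x :=
    fun x hx => aux_deriv s x (he.trans_le hx)
  have hn : ∀ x ∈ Ioi e,
      -s * ((1 + x) ^ s * x ^ (-1 - 2 * s) + (1 + x) ^ (s - 1) * x ^ (-1 - 2 * s)) ≤ 0 := by
    intro x hx
    have hx0 : 0 < x := he.trans hx
    have : 0 ≤ (1 + x) ^ s * x ^ (-1 - 2 * s) + (1 + x) ^ (s - 1) * x ^ (-1 - 2 * s) := by
      positivity
    nlinarith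
  have hi := integrableOn_Ioi_deriv_of_nonpos' hd hn (aux_tendsto s hs0)
  have hv := integral_Ioi_of_hasDerivAt_of_nonpos' hd hn (aux_tendsto s hs0)
  constructor
  · have := Integrable.const_mul hi (-s)⁻¹
    refine this.congr (Eventually.of_forall fun t => ?_)
    simp only
    field_simp
  · rw [integral_const_mul] at hv
    rw [eq_div_iff hs0.ne']
    linarith

lemma aux_image (e : ℝ) (he : 0 < e) :
    (fun t : ℝ => t / (1 + t)) '' (Ioi e) = Ioo (e / (1 + e)) 1 := by
  ext r
  constructor
  · rintro ⟨t, ht, rfl⟩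
    have ht' : e < t := ht
    have : 0 < t := he.trans ht
    constructor
    · rw [div_lt_div_iff₀ (by positivity) (by positivity)]; nlinarith
    · rw [div_lt_one (by positivity)]; linarith
  · rintro ⟨h1, h2⟩
    rw [div_lt_iff₀ (by positivity)] at h1
    have h3 : 0 < 1 - r := by linarith
    refine ⟨r / (1 - r), ?_, ?_⟩
    · show e < r / (1 - r)
      rw [lt_div_iff₀ h3]; nlinarith
    · field_simp; ring

lemma aux_cov (s : ℝ) (e : ℝ) (he : 0 < e) :
    ∫ r in Ioo (e / (1 + e)) 1, (max (1 - r) 0) ^ s * r ^ (-1 - 2 * s)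
      = ∫ t in Ioi e, (1 + t) ^ (s - 1) * t ^ (-1 - 2 * s) := by
  have hf' : ∀ x ∈ Ioi e, HasDerivWithinAt (fun t : ℝ => t / (1 + t)) (1 / (1 + x) ^ 2)
      (Ioi e) x := by
    intro x hx
    have hx0 : 0 < x := he.trans hx
    have := (hasDerivAt_id x).div ((hasDerivAt_id x).const_add 1) (by simp; positivity)
    apply HasDerivAt.hasDerivWithinAt
    refine this.congr_deriv ?_
    simp
  have hinj : InjOn (fun t : ℝ => t / (1 + t)) (Ioi e) := by
    intro x hx y hy hxy
    have hx0 : 0 < x := he.trans hx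
    have hy0 : 0 < y := he.trans hy
    have hxy' : x / (1 + x) = y / (1 + y) := hxy
    rw [div_eq_div_iff (by positivity) (by positivity)] at hxy'
    linarith
  rw [← aux_image e he, integral_image_eq_integral_abs_deriv_smul measurableSet_Ioi hf' hinj]
  refine setIntegral_congr_fun measurableSet_Ioi fun t ht => ?_
  have ht0 : 0 < t := he.trans ht
  have hu : 0 < 1 + t := by positivity
  have h1 : max (1 - t / (1 + t)) 0 = (1 + t)⁻¹ := by
    rw [max_eq_left]
    · field_simp; ring
    · rw [sub_nonneg, div_le_one hu]; linarith
  simp only [smul_eq_mul]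
  rw [h1, abs_of_pos (by positivity), Real.inv_rpow hu.le, ← Real.rpow_neg hu.le,
    Real.div_rpow ht0.le hu.le, div_eq_mul_inv (t ^ _), ← Real.rpow_neg hu.le, one_div,
    ← Real.rpow_natCast, ← Real.rpow_neg hu.le]
  rw [show (1 + t) ^ (s - 1) = (1 + t) ^ (-((2 : ℕ) : ℝ)) * (1 + t) ^ (-s)
    * (1 + t) ^ (-(-1 - 2 * s)) by
      rw [← Real.rpow_add hu, ← Real.rpow_add hu]; congr 1; push_cast; ring]
  ring

lemma aux_T_val (s : ℝ) (hs0 : 0 < s) (c : ℝ) (hc : 0 < c) :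
    ∫ t in Ioi c, t ^ (-1 - 2 * s) = c ^ (-2 * s) / (2 * s) := by
  rw [integral_Ioi_rpow_of_lt (by linarith) hc, show -1 - 2 * s + 1 = - 2 * s by ring, neg_mul, neg_div_neg_eq]

lemma aux_alg (s e : ℝ) (hs0 : 0 < s) (hs1 : s < 1) (he : 0 < e) (he1 : e < 1) :
    (1 + e) ^ s - 1 - (1 - e) ^ s * ((1 + e) ^ (2 * s) - 1) / 2 ≤ s * e ^ 2 := by
  have hp1 : (1 + e) ^ s ≤ 1 + s * e := _root_.rpow_one_add_le_one_add_mul_self (by linarith) hs0.le hs1.le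
  have hp2 : 1 ≤ (1 + e) ^ s := Real.one_le_rpow (by linarith) hs0.le
  have hq : 1 - e ≤ (1 - e) ^ s := by
    have := Real.rpow_le_rpow_of_exponent_ge (x := 1 - e) (by linarith) (by linarith) hs1.le
    simpa using this
  have hpp : (1 + e) ^ (2 * s) = (1 + e) ^ s * (1 + e) ^ s := by
    rw [← Real.rpow_add (by linarith)]; congr 1; ring
  have hpq : 1 - e ^ 2 ≤ (1 - e) ^ s * (1 + e) ^ s := by
    rw [← Real.mul_rpow (by linarith) (by linarith)]
    have := Real.rpow_le_rpow_of_exponent_ge (x := (1 - e) * (1 + e)) (by nlinarith) (by nlinarith) hs1.le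
    rw [Real.rpow_one] at this
    nlinarith
  rw [hpp]
  generalize (1 + e) ^ s = p at *
  generalize (1 - e) ^ s = q at *
  have h : 1 - q * (p + 1) / 2 ≤ e := by nlinarith
  calc p - 1 - q * (p * p - 1) / 2 = (p - 1) * (1 - q * (p + 1) / 2) := by ring
    _ ≤ (p - 1) * e := by gcongr
    _ ≤ (s * e) * e := by gcongr; linarith
    _ = s * e ^ 2 := by ring

lemma aux_J (s e : ℝ) (hs0 : 0 < s) (hs1 : s < 1) (he : 0 < e) (he1 : e < 1) :
    ∫ t in Ioi e, (((max (1 + t) 0) ^ s + (max (1 - t) 0) ^ s) / 2 - 1) * t ^ (-1 - 2 * s)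
      ≤ e ^ (2 - 2 * s) / 2 := by
  set a := e / (1 + e) with ha
  have ha0 : 0 < a := by positivity
  have hae : a ≤ e := by rw [ha, div_le_iff₀ (by positivity)]; nlinarith
  have ha1 : a < 1 := by linarith
  set T : ℝ → ℝ := fun t => t ^ (-1 - 2 * s) with hT
  set P : ℝ → ℝ := fun t => (max (1 - t) 0) ^ s * t ^ (-1 - 2 * s) with hP
  set R : ℝ → ℝ := fun t => (1 + t) ^ (s - 1) * t ^ (-1 - 2 * s) with hR
  set Q : ℝ → ℝ := fun t => (1 + t) ^ s * t ^ (-1 - 2 * s) with hQ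
  have hPi := fun c hc => aux_P_int s hs0 c hc
  have hTi := fun c hc => aux_T_int s hs0 c hc
  have hRi := aux_R_int s hs0 hs1 e he
  obtain ⟨hQRi, hQR⟩ := aux_QR s hs0 e he
  have hQi : IntegrableOn Q (Ioi e) := by
    refine (Integrable.sub hQRi hRi).congr (Eventually.of_forall fun t => ?_)
    simp [hQ]
  have hQR' : ∫ t in Ioi e, Q t = (1 + e) ^ s * e ^ (-2 * s) / s - ∫ t in Ioi e, R t := by
    rw [← hQR, integral_add hQi hRi]; ring
  have hcov : ∫ t in Ioo a 1, P t = ∫ t in Ioi e, R t := aux_cov s e he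
  have hsplit1 : ∫ t in Ioi a, P t = ∫ t in Ioo a 1, P t := by
    refine setIntegral_eq_of_subset_of_forall_sdiff_eq_zero measurableSet_Ioi Ioo_subset_Ioi_self ?_
    rintro t ⟨h1, h2⟩
    have : 1 ≤ t := by
      by_contra h
      exact h2 ⟨h1, not_le.1 h⟩
    simp only [hP]
    rw [max_eq_right (by linarith), Real.zero_rpow hs0.ne', zero_mul]
  have hsplit (F : ℝ → ℝ) (hF : IntegrableOn F (Ioi a)) :
      ∫ t in Ioi a, F t = (∫ t in Ioc a e, F t) + ∫ t in Ioi e, F t := by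
    rw [← Ioc_union_Ioi_eq_Ioi hae, setIntegral_union _ measurableSet_Ioi
      (hF.mono_set Ioc_subset_Ioi_self) (hF.mono_set (Ioi_subset_Ioi hae))]
    exact Ioc_disjoint_Ioi le_rfl
  have hs1' := hsplit P (hPi a ha0)
  have hs2' := hsplit T (hTi a ha0)
  have hTa : ∫ t in Ioi a, T t = a ^ (-2 * s) / (2 * s) := aux_T_val s hs0 a ha0
  have hTe : ∫ t in Ioi e, T t = e ^ (-2 * s) / (2 * s) := aux_T_val s hs0 e he
  have hlow : (1 - e) ^ s * ∫ t in Ioc a e, T t ≤ ∫ t in Ioc a e, P t := by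
    rw [← integral_const_mul]
    refine setIntegral_mono_on (((hTi a ha0).mono_set Ioc_subset_Ioi_self).const_mul _)
      ((hPi a ha0).mono_set Ioc_subset_Ioi_self) measurableSet_Ioc ?_
    rintro t ⟨h1, h2⟩
    have ht0 : 0 < t := ha0.trans h1
    simp only [hT, hP]
    have : (1 - e) ^ s ≤ (max (1 - t) 0) ^ s :=
      Real.rpow_le_rpow (by linarith) (le_trans (by linarith) (le_max_left _ _)) hs0.le
    gcongr
  have haa : a ^ (-2 * s) = e ^ (-2 * s) * (1 + e) ^ (2 * s) := by
    rw [ha, Real.div_rpow he.le (by positivity), div_eq_mul_inv, ← Real.rpow_neg (by positivity)]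
    congr 2; ring
  have hmain : ∫ t in Ioi e, (((max (1 + t) 0) ^ s + (max (1 - t) 0) ^ s) / 2 - 1)
      * t ^ (-1 - 2 * s) = ((∫ t in Ioi e, Q t) + ∫ t in Ioi e, P t) / 2 - ∫ t in Ioi e, T t := by
    rw [← integral_add hQi (hPi e he), ← integral_div,
      ← integral_sub (f := fun t => (Q t + P t) / 2) ((hQi.add (hPi e he)).div_const 2) (hTi e he)]
    refine setIntegral_congr_fun measurableSet_Ioi fun t ht => ?_
    have ht0 : 0 < t := he.trans ht
    simp only [hQ, hP]
    rw [max_eq_left (by linarith : 0 ≤ 1 + t)]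
    ring
  have halg := aux_alg s e hs0 hs1 he he1
  have hE : e ^ (2 - 2 * s) = e ^ (-2 * s) * e ^ 2 := by
    rw [← Real.rpow_natCast, ← Real.rpow_add he]; congr 1; push_cast; ring
  rw [hmain, hE]
  have hE0 : 0 < e ^ (-2 * s) := by positivity
  have key : ((∫ t in Ioi e, Q t) + ∫ t in Ioi e, P t) / 2 - ∫ t in Ioi e, T t
      ≤ e ^ (-2 * s) / (2 * s) *
        ((1 + e) ^ s - 1 - (1 - e) ^ s * ((1 + e) ^ (2 * s) - 1) / 2) := by
    have hTd : ∫ t in Ioc a e, T t = e ^ (-2 * s) / (2 * s) * ((1 + e) ^ (2 * s) - 1) := by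
      have : ∫ t in Ioc a e, T t = a ^ (-2 * s) / (2 * s) - e ^ (-2 * s) / (2 * s) := by linarith
      rw [this, haa]; ring
    rw [hTd] at hlow
    have hPe : ∫ t in Ioi e, P t = (∫ t in Ioi e, R t) - ∫ t in Ioc a e, P t := by linarith
    rw [hPe, hQR', hTe]
    have : (1 + e) ^ s * e ^ (-2 * s) / s = 2 * (e ^ (-2 * s) / (2 * s) * (1 + e) ^ s) := by
      field_simp
    rw [this]
    linarith
  refine key.trans ?_
  calc _ ≤ e ^ (-2 * s) / (2 * s) * (s * e ^ 2) := by gcongr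
    _ = _ := by field_simp

lemma aux_1d (s : ℝ) (hs0 : 0 < s) (hs1 : s < 1) :
    ∫ t in Ioi (0:ℝ), (((max (1 + t) 0) ^ s + (max (1 - t) 0) ^ s) / 2 - 1) * t ^ (-1 - 2 * s)
      ≤ 0 := by
  set F : ℝ → ℝ := fun t => (((max (1 + t) 0) ^ s + (max (1 - t) 0) ^ s) / 2 - 1)
    * t ^ (-1 - 2 * s) with hF
  by_cases hi : IntegrableOn F (Ioi 0)
  swap
  · exact (integral_undef hi).le
  have hU : (⋃ n : ℕ, Ioi (1 / ((n : ℝ) + 1 + 1))) = Ioi (0 : ℝ) := by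
    ext t
    simp only [mem_iUnion, mem_Ioi]
    constructor
    · rintro ⟨n, hn⟩
      exact lt_trans (by positivity) hn
    · intro ht
      obtain ⟨n, hn⟩ := exists_nat_one_div_lt ht
      refine ⟨n, lt_trans ?_ hn⟩
      apply one_div_lt_one_div_of_lt <;> first | positivity | linarith
  have ht := tendsto_setIntegral_of_monotone (μ := volume) (f := F)
    (s := fun n : ℕ => Ioi (1 / ((n : ℝ) + 1 + 1))) (fun _ => measurableSet_Ioi)
    (by
      intro m n hmn
      apply Ioi_subset_Ioi
      have : (m : ℝ) ≤ n := by exact_mod_cast hmn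
      gcongr) (by rw [hU]; exact hi)
  rw [hU] at ht
  have hz : Tendsto (fun n : ℕ => 1 / ((n : ℝ) + 1 + 1)) atTop (𝓝 0) := by
    have := (tendsto_add_atTop_iff_nat 1).2 (tendsto_one_div_add_atTop_nhds_zero_nat (𝕜 := ℝ))
    simpa using this
  have hb : Tendsto (fun n : ℕ => (1 / ((n : ℝ) + 1 + 1)) ^ (2 - 2 * s) / 2) atTop (𝓝 0) := by
    have := (hz.rpow_const (p := 2 - 2 * s) (Or.inr (by linarith))).div_const 2
    rwa [Real.zero_rpow (by linarith), zero_div] at this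
  refine le_of_tendsto_of_tendsto' ht hb fun n => ?_
  apply aux_J s _ hs0 hs1 (by positivity)
  rw [div_lt_one (by positivity)]
  have : (0:ℝ) ≤ n := by positivity
  linarith

noncomputable def auxg (s t : ℝ) : ℝ := ((max (1 + t) 0) ^ s + (max (1 - t) 0) ^ s) / 2 - 1

lemma auxg_neg (s t : ℝ) : auxg s (-t) = auxg s t := by
  simp only [auxg, sub_neg_eq_add, ← sub_eq_add_neg]; ring

lemma auxg_abs (s t : ℝ) : auxg s |t| = auxg s t := by
  rcases abs_choice t with h | h <;> rw [h]
  exact auxg_neg s t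

lemma auxg_lt (s t : ℝ) (hs0 : 0 < s) (hs1 : s < 1) (ht : t ≠ 0) (ht1 : |t| ≤ 1) :
    auxg s t < 0 := by
  obtain ⟨h1, h2⟩ := abs_le.1 ht1
  have a1 := _root_.rpow_one_add_lt_one_add_mul_self (s := t) h1 ht hs0 hs1
  have a2 := _root_.rpow_one_add_lt_one_add_mul_self (s := -t) (by linarith)
    (neg_ne_zero.2 ht) hs0 hs1
  rw [← sub_eq_add_neg] at a2
  rw [auxg, max_eq_left (by linarith), max_eq_left (by linarith)]
  linarith

lemma auxg_zero (s : ℝ) : auxg s 0 = 0 := by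
  simp [auxg]

lemma auxg_bound1 (s t : ℝ) (hs0 : 0 < s) (hs1 : s < 1) (ht1 : |t| ≤ 1) :
    |auxg s t| ≤ t ^ 2 := by
  have hle : auxg s t ≤ 0 := by
    by_cases h : t = 0
    · rw [h, auxg_zero]
    · exact (auxg_lt s t hs0 hs1 h ht1).le
  rw [abs_of_nonpos hle]
  obtain ⟨h1, h2⟩ := abs_le.1 ht1
  rw [auxg, max_eq_left (by linarith), max_eq_left (by linarith)]
  have hp : 0 ≤ (1 + t) ^ s := Real.rpow_nonneg (by linarith) _
  have hq : 0 ≤ (1 - t) ^ s := Real.rpow_nonneg (by linarith) _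
  have h0 : 0 ≤ (1 + t) * (1 - t) := mul_nonneg (by linarith) (by linarith)
  have hpq : 1 - t ^ 2 ≤ (1 + t) ^ s * (1 - t) ^ s := by
    rw [← Real.mul_rpow (by linarith) (by linarith)]
    rcases h0.eq_or_lt with h | h
    · rw [← h, Real.zero_rpow hs0.ne']; nlinarith
    · have := Real.rpow_le_rpow_of_exponent_ge h (by nlinarith [sq_nonneg t]) hs1.le
      rw [Real.rpow_one] at this
      nlinarith
  generalize (1 + t) ^ s = p at *
  generalize (1 - t) ^ s = q at *
  by_contra hcon
  have hm : p + q < 2 * (1 - t ^ 2) := by linarith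
  have hz : 0 ≤ 1 - t ^ 2 := by nlinarith
  have : (p + q) ^ 2 < (2 * (1 - t ^ 2)) ^ 2 := by
    apply pow_lt_pow_left₀ hm (by positivity) (by norm_num)
  nlinarith [sq_nonneg (p - q), sq_nonneg t]

lemma auxg_bound2 (s t r : ℝ) (hs0 : 0 < s) (hs1 : s < 1) (ht : |t| ≤ r) (hr : 1 ≤ r) :
    |auxg s t| ≤ r ^ s := by
  have hr0 : 0 < r := by linarith
  have h1r : 1 ≤ r ^ s := Real.one_le_rpow hr hs0.le
  rw [← auxg_abs]
  by_cases h : |t| ≤ 1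
  · refine (auxg_bound1 s |t| hs0 hs1 (by rwa [abs_abs])).trans (le_trans ?_ h1r)
    have := abs_nonneg t
    nlinarith
  · push Not at h
    rw [auxg, max_eq_right (by linarith : 1 - |t| ≤ 0), Real.zero_rpow hs0.ne',
      max_eq_left (by linarith)]
    have a1 : 0 ≤ (1 + |t|) ^ s := by positivity
    have a2 : (1 + |t|) ^ s ≤ (2 * r) ^ s := Real.rpow_le_rpow (by positivity) (by linarith) hs0.le
    rw [Real.mul_rpow (by norm_num) hr0.le] at a2
    have a3 : (2:ℝ) ^ s ≤ 2 := by
      have := Real.rpow_le_rpow_of_exponent_le (x := 2) (by norm_num) hs1.le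
      simpa using this
    have a4 : (2:ℝ) ^ s * r ^ s ≤ 2 * r ^ s := by gcongr
    rw [abs_le]
    constructor <;> linarith

lemma auxg_meas (s : ℝ) : Measurable (auxg s) := by
  unfold auxg
  fun_prop

lemma aux_radial (d : ℕ) (s : ℝ) (hs0 : 0 < s) (hs1 : s < 1) :
    Integrable (fun y : EuclideanSpace ℝ (Fin (d + 1)) =>
      (fun r : ℝ => (if r < 1 then r ^ 2 else r ^ s) * r ^ (-((d : ℝ) + 1 + 2 * s))) ‖y‖) := by
  refine (integrable_fun_norm_addHaar (E := EuclideanSpace ℝ (Fin (d + 1))) (F := ℝ) volume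
    (f := fun r : ℝ => (if r < 1 then r ^ 2 else r ^ s) * r ^ (-((d : ℝ) + 1 + 2 * s)))).2 ?_
  simp only [finrank_euclideanSpace, Fintype.card_fin, Nat.add_sub_cancel, smul_eq_mul]
  have hpow : ∀ r : ℝ, 0 < r → r ^ d * r ^ (-((d : ℝ) + 1 + 2 * s)) = r ^ (-1 - 2 * s) := by
    intro r hr
    rw [← Real.rpow_natCast, ← Real.rpow_add hr]; congr 1; ring
  rw [← Ioo_union_Ici_eq_Ioi (zero_lt_one' ℝ)]
  apply IntegrableOn.union
  · have h : IntegrableOn (fun r : ℝ => r ^ (1 - 2 * s)) (Ioo 0 1) :=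
      (intervalIntegral.integrableOn_Ioo_rpow_iff zero_lt_one).2 (by linarith)
    refine h.congr_fun (fun r hr => ?_) measurableSet_Ioo
    simp only [hr.2, if_true]
    rw [mul_left_comm, hpow r hr.1, ← Real.rpow_natCast, ← Real.rpow_add hr.1]
    congr 1; push_cast; ring
  · rw [integrableOn_Ici_iff_integrableOn_Ioi]
    have h : IntegrableOn (fun r : ℝ => r ^ (-1 - s)) (Ioi 1) :=
      integrableOn_Ioi_rpow_of_lt (by linarith) zero_lt_one
    refine h.congr_fun (fun r hr => ?_) measurableSet_Ioi
    have hr1 : 1 < r := hr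
    have hr0 : 0 < r := by linarith
    simp only [hr1.not_gt, if_false]
    rw [mul_left_comm, hpow r hr0, ← Real.rpow_add hr0]
    congr 1; ring

lemma aux_coord_le {d : ℕ} (y : EuclideanSpace ℝ (Fin (d + 1))) : |y (Fin.last d)| ≤ ‖y‖ := by
  simpa using PiLp.norm_apply_le y (Fin.last d)

lemma aux_int (d : ℕ) (s : ℝ) (hs0 : 0 < s) (hs1 : s < 1) :
    Integrable (fun y : EuclideanSpace ℝ (Fin (d + 1)) =>
      auxg s (y (Fin.last d)) * ‖y‖ ^ (-((d : ℝ) + 1 + 2 * s))) := by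
  refine (aux_radial d s hs0 hs1).mono' ?_ (Eventually.of_forall fun y => ?_)
  · apply Measurable.aestronglyMeasurable
    apply Measurable.mul
    · exact (auxg_meas s).comp (by fun_prop)
    · fun_prop
  · rw [norm_mul, Real.norm_eq_abs, Real.norm_of_nonneg (by positivity)]
    have hc := aux_coord_le y
    simp only
    gcongr
    split_ifs with h
    · refine (auxg_bound1 s _ hs0 hs1 (by linarith)).trans ?_
      rw [← sq_abs]
      gcongr
    · exact auxg_bound2 s _ _ hs0 hs1 hc (not_lt.1 h)

lemma aux_scaled (s c : ℝ) (hs0 : 0 < s) (hs1 : s < 1) :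
    ∫ r in Ioi (0:ℝ), auxg s (r * c) * r ^ (-1 - 2 * s) ≤ 0 := by
  have habs : ∀ r ∈ Ioi (0:ℝ), auxg s (r * c) * r ^ (-1 - 2 * s)
      = auxg s (|c| * r) * r ^ (-1 - 2 * s) := by
    intro r hr
    rw [← auxg_abs, abs_mul, abs_of_pos hr, mul_comm r]
  rw [setIntegral_congr_fun measurableSet_Ioi habs]
  rcases (abs_nonneg c).eq_or_lt with h | h
  · rw [← h]; simp [auxg_zero]
  · have h1 := integral_comp_mul_left_Ioi (fun t : ℝ => auxg s t * t ^ (-1 - 2 * s)) 0 h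
    have h2 : ∫ r in Ioi (0:ℝ), auxg s (|c| * r) * r ^ (-1 - 2 * s)
        = |c| ^ (1 + 2 * s) * ∫ r in Ioi (0:ℝ), auxg s (|c| * r) * (|c| * r) ^ (-1 - 2 * s) := by
      rw [← integral_const_mul]
      refine setIntegral_congr_fun measurableSet_Ioi fun r hr => ?_
      have hr0 : 0 < r := hr
      rw [Real.mul_rpow h.le hr0.le]
      have : |c| ^ (1 + 2 * s) * |c| ^ (-1 - 2 * s) = 1 := by
        rw [← Real.rpow_add h]; ring_nf; exact Real.rpow_zero _
      linear_combination (- auxg s (|c| * r) * r ^ (-1 - 2 * s)) * this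
    rw [h2, h1, mul_zero, smul_eq_mul]
    have h3 : ∫ t in Ioi (0:ℝ), auxg s t * t ^ (-1 - 2 * s) ≤ 0 := aux_1d s hs0 hs1
    exact mul_nonpos_of_nonneg_of_nonpos (by positivity)
      (mul_nonpos_of_nonneg_of_nonpos (by positivity) h3)

lemma aux_nd (d : ℕ) (s : ℝ) (hs0 : 0 < s) (hs1 : s < 1) :
    ∫ y : EuclideanSpace ℝ (Fin (d + 1)),
      auxg s (y (Fin.last d)) * ‖y‖ ^ (-((d : ℝ) + 1 + 2 * s)) ≤ 0 := by
  set E := EuclideanSpace ℝ (Fin (d + 1)) with hE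
  set f : E → ℝ := fun y => auxg s (y (Fin.last d)) * ‖y‖ ^ (-((d : ℝ) + 1 + 2 * s)) with hf
  have hfi : Integrable f := aux_int d s hs0 hs1
  set H : sphere (0 : E) 1 × Ioi (0 : ℝ) → ℝ := fun p => f ((p.2 : ℝ) • (p.1 : E)) with hH
  have hHf : ∀ x : ({(0 : E)}ᶜ : Set E), H (homeomorphUnitSphereProd E x) = f x := by
    intro x
    have hx : ‖(x : E)‖ ≠ 0 := norm_ne_zero_iff.2 x.2
    simp only [hH, homeomorphUnitSphereProd_apply_snd_coe, homeomorphUnitSphereProd_apply_fst_coe]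
    rw [smul_smul, mul_inv_cancel₀ hx, one_smul]
  have hmp := (volume : Measure E).measurePreserving_homeomorphUnitSphereProd
  have hemb := (homeomorphUnitSphereProd E).measurableEmbedding
  have h1 : ∫ y, f y = ∫ p, H p ∂((volume : Measure E).toSphere.prod
      (.volumeIoiPow (Module.finrank ℝ E - 1))) := by
    rw [← hmp.integral_comp hemb]
    simp only [hHf]
    rw [integral_subtype_comap (measurableSet_singleton _).compl f, restrict_compl_singleton]
  have h2 : Integrable H ((volume : Measure E).toSphere.prod
      (.volumeIoiPow (Module.finrank ℝ E - 1))) := by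
    rw [← hmp.integrable_comp_emb hemb]
    have : (H ∘ homeomorphUnitSphereProd E) = f ∘ Subtype.val := funext hHf
    rw [this, ← integrableOn_iff_comap_subtypeVal (measurableSet_singleton _).compl]
    exact hfi.integrableOn
  rw [h1, integral_prod _ h2]
  refine integral_nonpos fun θ => ?_
  have hθ : ‖(θ : E)‖ = 1 := by simp
  have hdim : Module.finrank ℝ E - 1 = d := by
    have : Module.finrank ℝ E = d + 1 := finrank_euclideanSpace_fin
    omega
  rw [hdim]
  simp only [Measure.volumeIoiPow, ENNReal.ofReal, hH, Pi.zero_apply]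
  rw [integral_withDensity_eq_integral_smul ((measurable_subtype_coe.pow_const _).real_toNNReal),
    integral_subtype_comap measurableSet_Ioi
      fun a : ℝ => Real.toNNReal (a ^ d) • f (a • (θ : E))]
  refine le_trans (le_of_eq ?_) (aux_scaled s ((θ : E) (Fin.last d)) hs0 hs1)
  refine setIntegral_congr_fun measurableSet_Ioi fun r hr => ?_
  have hr0 : 0 < r := hr
  simp only [hf]
  rw [NNReal.smul_def, Real.coe_toNNReal _ (pow_nonneg hr0.le _), norm_smul, hθ, mul_one,
    Real.norm_of_nonneg hr0.le, smul_eq_mul, PiLp.smul_apply, smul_eq_mul, mul_left_comm]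
  congr 1
  rw [← Real.rpow_natCast, ← Real.rpow_add hr0]; congr 1; ring

lemma aux_ball (d : ℕ) (s : ℝ) (hs0 : 0 < s) (hs1 : s < 1) :
    ∫ y in ball (0 : EuclideanSpace ℝ (Fin (d + 1))) (1 / 2),
      auxg s (y (Fin.last d)) * ‖y‖ ^ (-((d : ℝ) + 1 + 2 * s)) < 0 := by
  set E := EuclideanSpace ℝ (Fin (d + 1)) with hE
  set f : E → ℝ := fun y => auxg s (y (Fin.last d)) * ‖y‖ ^ (-((d : ℝ) + 1 + 2 * s)) with hf
  have hfi : Integrable f := aux_int d s hs0 hs1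
  have hsm : ∀ y ∈ ball (0 : E) (1 / 2), |y (Fin.last d)| ≤ 1 := by
    intro y hy
    rw [mem_ball_zero_iff] at hy
    linarith [aux_coord_le y]
  have hneg : ∀ y ∈ ball (0 : E) (1 / 2), y (Fin.last d) ≠ 0 → f y < 0 := by
    intro y hy hy0
    have hyn : 0 < ‖y‖ := lt_of_lt_of_le (abs_pos.2 hy0) (aux_coord_le y)
    exact mul_neg_of_neg_of_pos (auxg_lt s _ hs0 hs1 hy0 (hsm y hy)) (by positivity)
  suffices h : 0 < ∫ y in ball (0 : E) (1 / 2), (-f) y by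
    rw [integral_neg'] at h; linarith
  rw [setIntegral_pos_iff_support_of_nonneg_ae _ hfi.neg.integrableOn]
  · have hopen : IsOpen ({y : EuclideanSpace ℝ (Fin (d + 1)) | y (Fin.last d) ≠ 0} ∩ ball (0 : E) (1 / 2)) := by
      apply IsOpen.inter _ isOpen_ball
      have hc : Continuous fun y : EuclideanSpace ℝ (Fin (d + 1)) => y (Fin.last d) := by fun_prop
      exact isOpen_ne_fun hc continuous_const
    refine lt_of_lt_of_le (hopen.measure_pos volume ?_) (measure_mono ?_)
    · refine ⟨EuclideanSpace.single (Fin.last d) (1 / 4 : ℝ), ?_, ?_⟩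
      · simp
      · rw [mem_ball_zero_iff]
        have : ‖EuclideanSpace.single (Fin.last d) (1 / 4 : ℝ)‖ = ‖(1 / 4 : ℝ)‖ :=
          PiLp.norm_single _ _ _ _
        refine lt_of_eq_of_lt this ?_
        rw [Real.norm_of_nonneg] <;> norm_num
    · rintro y ⟨h1, h2⟩
      refine ⟨?_, h2⟩
      simp only [Function.mem_support, Pi.neg_apply]
      exact (neg_pos.2 (hneg y h2 h1)).ne'
  · filter_upwards [ae_restrict_mem measurableSet_ball] with y hy
    simp only [Pi.zero_apply, Pi.neg_apply]
    by_cases h0 : y (Fin.last d) = 0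
    · simp [hf, h0, auxg_zero]
    · linarith [hneg y hy h0]

theorem stmt6 (d : ℕ) (s lam Lam : ℝ) (hs0 : 0 < s) (hs1 : s < 1)
    (hlam : 0 < lam) (hlL : lam < Lam)
    (x : EuclideanSpace ℝ (Fin (d + 1))) (hx : x (Fin.last d) = 1) :
    (∫ y : EuclideanSpace ℝ (Fin (d + 1)),
        (((max ((x + y) (Fin.last d)) 0) ^ s + (max ((x - y) (Fin.last d)) 0) ^ s) / 2
            - (max (x (Fin.last d)) 0) ^ s) *
          ((1 - s) * (lam + (Lam - lam) * (if ‖y‖ < 1 / 2 then 1 else 0)) *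
            ‖y‖ ^ (-((d : ℝ) + 1 + 2 * s))))
      < 0 := by
  have hfi := aux_int d s hs0 hs1
  have h1 := aux_nd d s hs0 hs1
  have h2 := aux_ball d s hs0 hs1
  rw [← integral_indicator measurableSet_ball] at h2
  have hfb := hfi.indicator (measurableSet_ball (x := (0 : EuclideanSpace ℝ (Fin (d + 1)))) (ε := 1 / 2))
  have heq : ∀ y : EuclideanSpace ℝ (Fin (d + 1)),
      (((max ((x + y) (Fin.last d)) 0) ^ s + (max ((x - y) (Fin.last d)) 0) ^ s) / 2
            - (max (x (Fin.last d)) 0) ^ s) *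
          ((1 - s) * (lam + (Lam - lam) * (if ‖y‖ < 1 / 2 then 1 else 0)) *
            ‖y‖ ^ (-((d : ℝ) + 1 + 2 * s)))
      = (1 - s) * lam * (auxg s (y (Fin.last d)) * ‖y‖ ^ (-((d : ℝ) + 1 + 2 * s)))
        + (1 - s) * (Lam - lam) * (ball (0 : EuclideanSpace ℝ (Fin (d + 1))) (1 / 2)).indicator
          (fun y => auxg s (y (Fin.last d)) * ‖y‖ ^ (-((d : ℝ) + 1 + 2 * s))) y := by
    intro y
    rw [PiLp.add_apply, PiLp.sub_apply, hx, max_eq_left (zero_le_one' ℝ), Real.one_rpow]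
    by_cases h : ‖y‖ < 1 / 2
    · rw [indicator_of_mem (by rwa [mem_ball_zero_iff]), if_pos h, auxg]; ring
    · rw [indicator_of_notMem (by rwa [mem_ball_zero_iff]), if_neg h, auxg]; ring
  rw [integral_congr_ae (Eventually.of_forall heq), integral_add (hfi.const_mul _) (hfb.const_mul _),
    integral_const_mul, integral_const_mul]
  have p1 : 0 < (1 - s) * lam := mul_pos (by linarith) hlam
  have p2 : 0 < (1 - s) * (Lam - lam) := mul_pos (by linarith) (by linarith)
  have q1 := mul_nonpos_of_nonneg_of_nonpos p1.le h1
  have q2 := mul_neg_of_pos_of_neg p2 h2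
  linarith
end

section
/- Let s ∈ (0,1) and let u ∈ C(ℝ) satisfy (−Δ)^s u = 0 in (0,∞), u ≡ 0 on (−∞,0], and |u(x)| ≤ C(1+|x|^β) for all x, for some β < 2s. Then u(x) = K (x_+)^s for some constant K ∈ ℝ. -/
namespace Stmt8Aux
open MeasureTheory Set Filter Topology

/-- Weighted second difference. -/
noncomputable def D (s : ℝ) (f : ℝ → ℝ) (x r : ℝ) : ℝ :=
  (f (x + r) + f (x - r) - 2 * f x) * r ^ (-1 - 2 * s)

/-- `f` solves the equation at `x` (half-line form). -/
def Sol (s : ℝ) (f : ℝ → ℝ) (x : ℝ) : Prop :=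
  IntegrableOn (D s f x) (Ioi 0) ∧ ∫ r in Ioi (0:ℝ), D s f x r = 0

lemma Sol.sub {s x : ℝ} {f g : ℝ → ℝ} (hf : Sol s f x) (hg : Sol s g x) :
    Sol s (fun z => f z - g z) x := by
  have e : D s (fun z => f z - g z) x = fun r => D s f x r - D s g x r := by
    funext r; simp only [D]; ring
  refine ⟨?_, ?_⟩
  · rw [e]; exact hf.1.sub hg.1
  · rw [e, integral_sub hf.1 hg.1, hf.2, hg.2, sub_zero]

lemma Sol.const_mul {s x : ℝ} {f : ℝ → ℝ} (hf : Sol s f x) (c : ℝ) :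
    Sol s (fun z => c * f z) x := by
  have e : D s (fun z => c * f z) x = fun r => c * D s f x r := by
    funext r; simp only [D]; ring
  refine ⟨?_, ?_⟩
  · rw [e]; exact hf.1.const_mul c
  · rw [e, integral_const_mul, hf.2, mul_zero]

lemma Sol.sum {s x : ℝ} {f : ℕ → ℝ → ℝ} (N : ℕ) (hf : ∀ i, i < N → Sol s (f i) x) :
    Sol s (fun z => ∑ i ∈ Finset.range N, f i z) x := by
  have e : D s (fun z => ∑ i ∈ Finset.range N, f i z) x
      = fun r => ∑ i ∈ Finset.range N, D s (f i) x r := by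
    funext r
    simp only [D]
    rw [← Finset.sum_mul, Finset.sum_sub_distrib, Finset.sum_add_distrib, Finset.mul_sum]
  refine ⟨?_, ?_⟩
  · rw [e]
    exact integrable_finsetSum _ (fun i hi => (hf i (Finset.mem_range.1 hi)).1)
  · rw [e, integral_finsetSum _ (fun i hi => (hf i (Finset.mem_range.1 hi)).1)]
    exact Finset.sum_eq_zero (fun i hi => (hf i (Finset.mem_range.1 hi)).2)

lemma sol_of_full {s x : ℝ} {u : ℝ → ℝ}
    (h1 : Integrable (fun r : ℝ => (u (x + r) + u (x - r) - 2 * u x) / |r| ^ (1 + 2 * s)))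
    (h2 : ∫ r : ℝ, (u (x + r) + u (x - r) - 2 * u x) / |r| ^ (1 + 2 * s) = 0) :
    Sol s u x := by
  have e : ∀ r ∈ Ioi (0:ℝ), (u (x + r) + u (x - r) - 2 * u x) / |r| ^ (1 + 2 * s) = D s u x r := by
    intro r hr
    have hr : 0 < r := hr
    simp only [D]
    rw [abs_of_pos hr, div_eq_mul_inv, ← Real.rpow_neg hr.le]
    congr 2; ring
  refine ⟨(integrableOn_congr_fun e measurableSet_Ioi).1 h1.integrableOn, ?_⟩
  have h3 := integral_comp_abs (f := D s u x)
  have e2 : (fun r : ℝ => D s u x |r|) =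
      fun r : ℝ => (u (x + r) + u (x - r) - 2 * u x) / |r| ^ (1 + 2 * s) := by
    funext r
    simp only [D]
    rw [div_eq_mul_inv, ← Real.rpow_neg (abs_nonneg r)]
    have : (-1 - 2 * s) = -(1 + 2 * s) := by ring
    rw [this]
    rcases abs_cases r with h | h
    · rw [h.1]
    · rw [h.1]; congr 1; rw [← sub_eq_add_neg, sub_neg_eq_add]; ring
  rw [e2, h2] at h3
  linarith

/-- Maximum principle with far away tail. -/
lemma max_principle {s β C R A ε : ℝ} (hs0 : 0 < s) (hβ0 : 0 < β) (hβ : β < 2 * s)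
    (hC : 0 ≤ C) (hR : 0 < R) (hA : 2 * R ≤ A) (hε : 0 < ε)
    (htail : C * (2 ^ β * ((A - R) ^ (β - 2 * s) / (2 * s - β))) ≤ ε * (R ^ (-(2 * s)) / (2 * s)))
    {w : ℝ → ℝ} (hw : ContinuousOn w (Icc 0 R)) (hw0 : ∀ z ≤ 0, w z = 0)
    (hw1 : ∀ z, R ≤ z → z < A → w z ≤ ε) (hw2 : ∀ z, A ≤ z → w z ≤ C * z ^ β)
    (hsol : ∀ x, 0 < x → x < R → Sol s w x) :
    ∀ x ∈ Icc 0 R, w x ≤ ε := by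
  obtain ⟨x0, hx0, hmax⟩ := isCompact_Icc.exists_isMaxOn (nonempty_Icc.2 hR.le) hw
  have hmax : ∀ z ∈ Icc 0 R, w z ≤ w x0 := fun z hz => hmax hz
  suffices h : w x0 ≤ ε from fun x hx => (hmax x hx).trans h
  by_contra hcon
  push Not at hcon
  have hx0p : 0 < x0 := by
    rcases hx0.1.eq_or_lt with h | h
    · rw [← h, hw0 0 le_rfl] at hcon; linarith
    · exact h
  have hx0R : x0 < R := by
    rcases hx0.2.eq_or_lt with h | h
    · have := hw1 x0 h.ge (by linarith); linarith
    · exact h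
  obtain ⟨hi, h0⟩ := hsol x0 hx0p hx0R
  set m := w x0 with hm
  have hmpos : 0 < m := by linarith
  have hleft : ∀ z, z < A → w z ≤ m := by
    intro z hz
    rcases le_total z 0 with h | h
    · rw [hw0 z h]; exact hmpos.le
    rcases le_total z R with h' | h'
    · exact hmax z ⟨h, h'⟩
    · exact (hw1 z h' hz).trans hcon.le
  have i1 : IntegrableOn (fun r : ℝ => r ^ (-1 - 2 * s)) (Ioi R) :=
    integrableOn_Ioi_rpow_of_lt (by linarith) hR
  have i2 : IntegrableOn (fun r : ℝ => r ^ (β - 1 - 2 * s)) (Ioi (A - R)) :=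
    integrableOn_Ioi_rpow_of_lt (by linarith) (by linarith)
  have v1 : ∫ r in Ioi R, r ^ (-1 - 2 * s) = R ^ (-(2 * s)) / (2 * s) := by
    rw [integral_Ioi_rpow_of_lt (by linarith) hR]
    rw [show -1 - 2 * s + 1 = -(2 * s) by ring, neg_div_neg_eq]
  have v2 : ∫ r in Ioi (A - R), r ^ (β - 1 - 2 * s) = (A - R) ^ (β - 2 * s) / (2 * s - β) := by
    rw [integral_Ioi_rpow_of_lt (by linarith) (by linarith)]
    rw [show β - 1 - 2 * s + 1 = β - 2 * s by ring, ← neg_div_neg_eq]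
    congr 1 <;> ring
  let G : ℝ → ℝ := fun r => (Ioi R).indicator (fun r => (-m) * r ^ (-1 - 2 * s)) r
      + (Ioi (A - R)).indicator (fun r => C * 2 ^ β * r ^ (β - 1 - 2 * s)) r
  have j1 : IntegrableOn ((Ioi R).indicator (fun r => (-m) * r ^ (-1 - 2 * s))) (Ioi 0) := by
    apply Integrable.integrableOn
    exact IntegrableOn.integrable_indicator (i1.const_mul (-m)) measurableSet_Ioi
  have j2 : IntegrableOn ((Ioi (A - R)).indicator (fun r => C * 2 ^ β * r ^ (β - 1 - 2 * s))) (Ioi 0) := by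
    apply Integrable.integrableOn
    exact IntegrableOn.integrable_indicator (i2.const_mul _) measurableSet_Ioi
  have hG : IntegrableOn G (Ioi 0) := j1.add j2
  have vG : ∫ r in Ioi 0, G r = (-m) * (R ^ (-(2 * s)) / (2 * s))
      + C * 2 ^ β * ((A - R) ^ (β - 2 * s) / (2 * s - β)) := by
    rw [integral_add j1 j2, setIntegral_indicator measurableSet_Ioi,
      setIntegral_indicator measurableSet_Ioi, Ioi_inter_Ioi, Ioi_inter_Ioi,
      integral_const_mul, integral_const_mul]
    rw [sup_of_le_right hR.le, sup_of_le_right (by linarith : (0:ℝ) ≤ A - R), v1, v2]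
  -- pointwise bound, off a null set
  have hle : ∫ r in Ioi 0, D s w x0 r ≤ ∫ r in Ioi 0, G r := by
    have hne : ∀ᵐ r : ℝ ∂(volume.restrict (Ioi 0)), r ≠ A - R := by
      apply ae_restrict_of_ae
      exact (measure_eq_zero_iff_ae_notMem.1 (Real.volume_singleton (a := A - R))).mono
        (fun r hr => by simpa using hr)
    refine integral_mono_ae hi hG ?_
    filter_upwards [hne, ae_restrict_mem measurableSet_Ioi] with r hr hr0
    have hr0 : 0 < r := hr0
    have hp : 0 < r ^ (-1 - 2 * s) := Real.rpow_pos_of_pos hr0 _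
    have a1 : w (x0 - r) ≤ m := hleft _ (by linarith)
    simp only [G, D, indicator_apply, mem_Ioi]
    by_cases hrA : A - R < r
    · have hRr : R < r := by linarith
      rw [if_pos hrA, if_pos hRr]
      have a2 : w (x0 - r) = 0 := hw0 _ (by linarith)
      have a3 : w (x0 + r) ≤ m + C * (2 * r) ^ β := by
        have hq : 0 ≤ C * (2 * r) ^ β := by positivity
        rcases lt_or_ge (x0 + r) A with h | h
        · have := hleft _ h; linarith
        · have := hw2 _ h
          have h' : (x0 + r) ^ β ≤ (2 * r) ^ β :=
            Real.rpow_le_rpow (by linarith) (by linarith) hβ0.le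
          have := mul_le_mul_of_nonneg_left h' hC
          linarith
      have a4 : r ^ (β - 1 - 2 * s) = r ^ β * r ^ (-1 - 2 * s) := by
        rw [← Real.rpow_add hr0]; congr 1; ring
      rw [a4, a2]
      rw [Real.mul_rpow (by norm_num) hr0.le] at a3
      have : (w (x0 + r) + 0 - 2 * m) * r ^ (-1 - 2 * s) ≤ (-m + C * (2 ^ β * r ^ β)) * r ^ (-1 - 2 * s) := by
        apply mul_le_mul_of_nonneg_right _ hp.le; linarith
      linarith
    · have hrA' : r < A - R := lt_of_le_of_ne (not_lt.1 hrA) hr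
      rw [if_neg hrA, add_zero]
      have a3 : w (x0 + r) ≤ m := hleft _ (by linarith)
      by_cases hRr : R < r
      · rw [if_pos hRr]
        have a2 : w (x0 - r) = 0 := hw0 _ (by linarith)
        apply mul_le_mul_of_nonneg_right _ hp.le
        linarith
      · rw [if_neg hRr]
        apply mul_nonpos_of_nonpos_of_nonneg _ hp.le
        linarith
  rw [h0, vG] at hle
  have hq : 0 < R ^ (-(2 * s)) / (2 * s) := by
    have := Real.rpow_pos_of_pos hR (-(2 * s)); positivity
  have := mul_lt_mul_of_pos_right hcon hq
  linarith
end Stmt8Aux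

namespace Stmt8Aux
open MeasureTheory Set Filter Topology

lemma integrableOn_sub_left_rpow {p : ℝ} (hp : -1 < p) (c d : ℝ) :
    IntegrableOn (fun z : ℝ => (c - z) ^ p) (Ioo d c) := by
  rcases le_or_gt c d with h | h
  · rw [Ioo_eq_empty (not_lt.2 h)]; exact integrableOn_empty
  have h1 : IntervalIntegrable (fun z : ℝ => z ^ p) volume 0 (c - d) :=
    intervalIntegral.intervalIntegrable_rpow' hp
  have h2 := h1.comp_sub_left c
  have h3 : IntervalIntegrable (fun z : ℝ => (c - z) ^ p) volume d c := by
    simpa using h2.symm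
  exact ((intervalIntegrable_iff_integrableOn_Ioo_of_le h.le).1 h3)

lemma integrableOn_sub_right_rpow {p : ℝ} (hp : -1 < p) (c d : ℝ) :
    IntegrableOn (fun z : ℝ => (z - d) ^ p) (Ioo d c) := by
  rcases le_or_gt c d with h | h
  · rw [Ioo_eq_empty (not_lt.2 h)]; exact integrableOn_empty
  have h1 : IntervalIntegrable (fun z : ℝ => z ^ p) volume 0 (c - d) :=
    intervalIntegral.intervalIntegrable_rpow' hp
  have h2 := h1.comp_sub_right d
  have h3 : IntervalIntegrable (fun z : ℝ => (z - d) ^ p) volume d c := by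
    simpa using h2
  exact ((intervalIntegrable_iff_integrableOn_Ioo_of_le h.le).1 h3)

lemma integrableOn_beta {s : ℝ} (hs0 : 0 < s) (hs1 : s < 1) (z b : ℝ) :
    IntegrableOn (fun a : ℝ => (b - a) ^ (-s) * (a - z) ^ (s - 1)) (Ioo z b) := by
  rcases le_or_gt b z with h | h
  · rw [Ioo_eq_empty (not_lt.2 h)]; exact integrableOn_empty
  set m := (b + z) / 2 with hm
  have i1 := (integrableOn_sub_left_rpow (p := -s) (by linarith) b z).const_mul ((m - z) ^ (s - 1))
  have i2 := (integrableOn_sub_right_rpow (p := s - 1) (by linarith) b z).const_mul ((b - m) ^ (-s))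
  refine Integrable.mono' (i1.add i2) ?_ ?_
  · apply Measurable.aestronglyMeasurable
    fun_prop
  · filter_upwards [ae_restrict_mem measurableSet_Ioo] with a ha
    have h1 : 0 < b - a := by linarith [ha.2]
    have h2 : 0 < a - z := by linarith [ha.1]
    have p1 := Real.rpow_pos_of_pos h1 (-s)
    have p2 := Real.rpow_pos_of_pos h2 (s - 1)
    rw [Real.norm_of_nonneg (by positivity)]
    have q1 : 0 < (m - z) ^ (s - 1) := Real.rpow_pos_of_pos (by linarith) _
    have q2 : 0 < (b - m) ^ (-s) := Real.rpow_pos_of_pos (by linarith) _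
    simp only [Pi.add_apply]
    rcases le_total a m with h | h
    · have : (b - a) ^ (-s) ≤ (b - m) ^ (-s) :=
        Real.rpow_le_rpow_of_nonpos (by linarith) (by linarith) (by linarith)
      nlinarith
    · have : (a - z) ^ (s - 1) ≤ (m - z) ^ (s - 1) :=
        Real.rpow_le_rpow_of_nonpos (by linarith) (by linarith) (by linarith)
      nlinarith

/-- Martin kernel of `(0,a)` with pole at `a`. -/
noncomputable def M (s a z : ℝ) : ℝ := (max z 0) ^ s * (max (a - z) 0) ^ (s - 1)

lemma M_nonneg (s a z : ℝ) : 0 ≤ M s a z := by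
  unfold M; positivity

lemma M_of_nonpos {s : ℝ} (hs0 : 0 < s) {a z : ℝ} (hz : z ≤ 0) : M s a z = 0 := by
  unfold M; rw [max_eq_right hz, Real.zero_rpow hs0.ne', zero_mul]

lemma M_of_ge {s : ℝ} (hs1 : s < 1) {a z : ℝ} (hz : a ≤ z) : M s a z = 0 := by
  unfold M; rw [max_eq_right (a := a - z) (by linarith), Real.zero_rpow (by linarith), mul_zero]

lemma M_of_mem {s a z : ℝ} (hz : 0 ≤ z) (hza : z ≤ a) : M s a z = z ^ s * (a - z) ^ (s - 1) := by
  unfold M; rw [max_eq_left hz, max_eq_left (by linarith)]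

lemma measurable_M (s : ℝ) : Measurable (fun p : ℝ × ℝ => M s p.1 p.2) := by
  unfold M; fun_prop

lemma measurable_M_right (s a : ℝ) : Measurable (M s a) := by
  unfold M; fun_prop

lemma integrable_M {s : ℝ} (hs0 : 0 < s) (hs1 : s < 1) (a : ℝ) : Integrable (M s a) := by
  have i1 := (integrableOn_sub_left_rpow (p := s - 1) (by linarith) a 0).const_mul (a ^ s)
  have : IntegrableOn (M s a) (Ioo 0 a) := by
    refine Integrable.mono' i1 (measurable_M_right s a).aestronglyMeasurable ?_
    filter_upwards [ae_restrict_mem measurableSet_Ioo] with z hz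
    rw [Real.norm_of_nonneg (M_nonneg _ _ _), M_of_mem hz.1.le hz.2.le]
    have : 0 < (a - z) ^ (s - 1) := Real.rpow_pos_of_pos (by linarith [hz.2]) _
    have h2 : z ^ s ≤ a ^ s := Real.rpow_le_rpow hz.1.le hz.2.le hs0.le
    exact mul_le_mul_of_nonneg_right h2 this.le
  refine this.integrable_of_ae_notMem_eq_zero (Eventually.of_forall ?_)
  intro z hz
  rcases le_or_gt z 0 with h | h
  · exact M_of_nonpos hs0 h
  · rcases le_or_gt a z with h' | h'
    · exact M_of_ge hs1 h'
    · exact absurd ⟨h, h'⟩ hz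

lemma second_diff {f f' f'' : ℝ → ℝ} {x ρ C : ℝ}
    (h1 : ∀ z ∈ Icc (x - ρ) (x + ρ), HasDerivAt f (f' z) z)
    (h2 : ∀ z ∈ Icc (x - ρ) (x + ρ), HasDerivAt f' (f'' z) z)
    (hC : ∀ z ∈ Icc (x - ρ) (x + ρ), |f'' z| ≤ C)
    {r : ℝ} (hr0 : 0 ≤ r) (hr : r ≤ ρ) :
    |f (x + r) + f (x - r) - 2 * f x| ≤ 2 * C * r ^ 2 := by
  have hC0 : 0 ≤ C := (abs_nonneg _).trans (hC x ⟨by linarith, by linarith⟩)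
  have hf' : ∀ t ∈ Icc 0 r, |f' (x + t) - f' (x - t)| ≤ 2 * C * r := by
    intro t ht
    have := Convex.norm_image_sub_le_of_norm_hasDerivWithin_le (f := f') (f' := f'')
      (s := Icc (x - ρ) (x + ρ)) (x := x - t) (y := x + t) (C := C)
      (fun z hz => (h2 z hz).hasDerivWithinAt) (fun z hz => hC z hz) (convex_Icc _ _)
      ⟨by linarith [ht.2], by linarith [ht.1]⟩ ⟨by linarith [ht.1], by linarith [ht.2]⟩
    rw [Real.norm_eq_abs, Real.norm_eq_abs, show x + t - (x - t) = 2 * t by ring,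
      abs_of_nonneg (by linarith [ht.1] : 0 ≤ 2 * t)] at this
    have h3 : C * (2 * t) ≤ C * (2 * r) := mul_le_mul_of_nonneg_left (by linarith [ht.2]) hC0
    linarith
  have := Convex.norm_image_sub_le_of_norm_hasDerivWithin_le (f := fun t => f (x + t) + f (x - t))
      (f' := fun t => f' (x + t) - f' (x - t))
      (s := Icc 0 r) (x := 0) (y := r) (C := 2 * C * r)
      (fun t ht => by
        have e1 : HasDerivAt (fun t => f (x + t)) (f' (x + t)) t := by
          have := (h1 (x + t) ⟨by linarith [ht.1], by linarith [ht.2]⟩).comp_const_add x t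
          exact this
        have e2 : HasDerivAt (fun t => f (x - t)) (-f' (x - t)) t := by
          have := (h1 (x - t) ⟨by linarith [ht.2], by linarith [ht.1]⟩).comp_const_sub x t
          exact this
        have := (e1.add e2).hasDerivWithinAt (s := Icc 0 r)
        rw [← sub_eq_add_neg] at this
        exact this)
      (fun t ht => hf' t ht) (convex_Icc _ _) ⟨le_rfl, hr0⟩ ⟨hr0, le_rfl⟩
  simp only [Real.norm_eq_abs, add_zero, sub_zero, abs_of_nonneg hr0] at this
  calc |f (x + r) + f (x - r) - 2 * f x| = |f (x + r) + f (x - r) - (f x + f x)| := by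
        congr 1; ring
    _ ≤ _ := this
    _ = _ := by ring

lemma M_bounds {s x R b : ℝ} (hx : 0 < x) (hxR : x < R) :
    ∃ ρ C : ℝ, 0 < ρ ∧ ρ < x ∧ ρ < R - x ∧ 0 ≤ C ∧ ∀ a ∈ Icc R b, ∀ r, 0 ≤ r → r ≤ ρ →
      |M s a (x + r) + M s a (x - r) - 2 * M s a x| ≤ C * r ^ 2 ∧
      |M s a (x + r) - M s a x| ≤ C * r := by
  set ρ := min x (R - x) / 2 with hρ
  have hρ0 : 0 < ρ := by have : 0 < min x (R - x) := lt_min hx (by linarith)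
                         positivity
  have hρx : ρ < x := by have := min_le_left x (R - x); linarith
  have hρR : ρ < R - x := by have := min_le_right x (R - x); linarith
  let f1 : ℝ → ℝ → ℝ := fun a z => s * z ^ (s - 1) * (a - z) ^ (s - 1)
    + z ^ s * (-((s - 1) * (a - z) ^ (s - 1 - 1)))
  let f2 : ℝ → ℝ → ℝ := fun a z =>
    ((s * ((s - 1) * z ^ (s - 1 - 1))) * (a - z) ^ (s - 1)
      + s * z ^ (s - 1) * (-((s - 1) * (a - z) ^ (s - 1 - 1))))
    + ((s * z ^ (s - 1)) * (-((s - 1) * (a - z) ^ (s - 1 - 1)))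
      + z ^ s * (-((s - 1) * (-((s - 1 - 1) * (a - z) ^ (s - 1 - 1 - 1))))))
  set S := Icc R b ×ˢ Icc (x - ρ) (x + ρ) with hS
  have hSc : IsCompact S := isCompact_Icc.prod isCompact_Icc
  have pos : ∀ q ∈ S, 0 < q.2 ∧ 0 < q.1 - q.2 := by
    rintro ⟨a, z⟩ ⟨ha, hz⟩
    simp only [mem_Icc] at ha hz ⊢
    constructor <;> linarith
  have c1 : ∀ p : ℝ, ContinuousOn (fun q : ℝ × ℝ => q.2 ^ p) S := fun p =>
    ContinuousOn.rpow_const continuous_snd.continuousOn (fun q hq => Or.inl (pos q hq).1.ne')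
  have c2 : ∀ p : ℝ, ContinuousOn (fun q : ℝ × ℝ => (q.1 - q.2) ^ p) S := fun p =>
    ContinuousOn.rpow_const (by fun_prop) (fun q hq => Or.inl (pos q hq).2.ne')
  have d1 : ContinuousOn (fun q : ℝ × ℝ => f1 q.1 q.2) S := by
    have := c1 s; have := c1 (s - 1); have := c2 (s - 1); have := c2 (s - 1 - 1)
    simp only [f1]; fun_prop
  have d2 : ContinuousOn (fun q : ℝ × ℝ => f2 q.1 q.2) S := by
    have := c1 s; have := c1 (s - 1); have := c1 (s - 1 - 1)
    have := c2 (s - 1); have := c2 (s - 1 - 1); have := c2 (s - 1 - 1 - 1)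
    simp only [f2]; fun_prop
  obtain ⟨C1, hC1⟩ := hSc.exists_bound_of_continuousOn d1
  obtain ⟨C2, hC2⟩ := hSc.exists_bound_of_continuousOn d2
  refine ⟨ρ, max C1 0 + 2 * max C2 0, hρ0, hρx, hρR, by positivity, ?_⟩
  intro a ha r hr0 hr
  have hz0 : ∀ z ∈ Icc (x - ρ) (x + ρ), 0 < z ∧ 0 < a - z := fun z hz => pos (a, z) ⟨ha, hz⟩
  have e1 : ∀ z ∈ Icc (x - ρ) (x + ρ), HasDerivAt (fun z => z ^ s * (a - z) ^ (s - 1)) (f1 a z) z := by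
    intro z hz
    obtain ⟨p1, p2⟩ := hz0 z hz
    have g1 := Real.hasDerivAt_rpow_const (x := z) (p := s) (Or.inl p1.ne')
    have g2 := (Real.hasDerivAt_rpow_const (x := a - z) (p := s - 1) (Or.inl p2.ne')).comp_const_sub a z
    exact g1.mul g2
  have e2 : ∀ z ∈ Icc (x - ρ) (x + ρ), HasDerivAt (f1 a) (f2 a z) z := by
    intro z hz
    obtain ⟨p1, p2⟩ := hz0 z hz
    have g0 := Real.hasDerivAt_rpow_const (x := z) (p := s) (Or.inl p1.ne')
    have g1 := (Real.hasDerivAt_rpow_const (x := z) (p := s - 1) (Or.inl p1.ne')).const_mul s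
    have g2 := (Real.hasDerivAt_rpow_const (x := a - z) (p := s - 1) (Or.inl p2.ne')).comp_const_sub a z
    have g3 := (((Real.hasDerivAt_rpow_const (x := a - z) (p := s - 1 - 1) (Or.inl p2.ne')).comp_const_sub a z).const_mul (s - 1)).neg
    exact (g1.mul g2).add (g0.mul g3)
  have em : ∀ z ∈ Icc (x - ρ) (x + ρ), M s a z = z ^ s * (a - z) ^ (s - 1) := fun z hz =>
    M_of_mem (hz0 z hz).1.le (by linarith [(hz0 z hz).2])
  have m1 : x + r ∈ Icc (x - ρ) (x + ρ) := ⟨by linarith, by linarith⟩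
  have m2 : x - r ∈ Icc (x - ρ) (x + ρ) := ⟨by linarith, by linarith⟩
  have m3 : x ∈ Icc (x - ρ) (x + ρ) := ⟨by linarith, by linarith⟩
  have k1 : 0 ≤ max C1 0 := le_max_right _ _
  have k2 : 0 ≤ max C2 0 := le_max_right _ _
  rw [em _ m1, em _ m2, em _ m3]
  constructor
  · have := second_diff (f := fun z => z ^ s * (a - z) ^ (s - 1)) (C := max C2 0) e1 e2
      (fun z hz => (hC2 (a, z) ⟨ha, hz⟩).trans (le_max_left _ _)) hr0 hr
    refine this.trans ?_
    nlinarith [sq_nonneg r]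
  · have := Convex.norm_image_sub_le_of_norm_hasDerivWithin_le
      (f := fun z => z ^ s * (a - z) ^ (s - 1)) (f' := f1 a)
      (s := Icc (x - ρ) (x + ρ)) (x := x) (y := x + r) (C := max C1 0)
      (fun z hz => (e1 z hz).hasDerivWithinAt)
      (fun z hz => (hC1 (a, z) ⟨ha, hz⟩).trans (le_max_left _ _)) (convex_Icc _ _) m3 m1
    rw [Real.norm_eq_abs, Real.norm_eq_abs, add_sub_cancel_left, abs_of_nonneg hr0] at this
    refine this.trans ?_
    nlinarith

lemma integrable_dom {s x ρ C k : ℝ} (hs0 : 0 < s) (hs1 : s < 1) (hρ : 0 < ρ)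
    {F H : ℝ → ℝ} (hF : AEStronglyMeasurable F (volume.restrict (Ioi 0)))
    (hH : Integrable H) (hH0 : ∀ z, 0 ≤ H z) (hk : 0 ≤ k)
    (h1 : ∀ r, 0 < r → r < ρ → |F r| ≤ C * r ^ 2 * r ^ (-1 - 2 * s))
    (h2 : ∀ r, ρ ≤ r → |F r| ≤ (H (x + r) + H (x - r) + k) * r ^ (-1 - 2 * s)) :
    IntegrableOn F (Ioi 0) := by
  rw [← Ioo_union_Ici_eq_Ioi hρ]
  apply IntegrableOn.union
  · have i1 := (integrableOn_sub_right_rpow (p := 1 - 2 * s) (by linarith) ρ 0).const_mul C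
    refine Integrable.mono' i1 (hF.mono_set Ioo_subset_Ioi_self) ?_
    filter_upwards [ae_restrict_mem measurableSet_Ioo] with r hr
    refine (h1 r hr.1 hr.2).trans (le_of_eq ?_)
    rw [mul_assoc, sub_zero, ← Real.rpow_natCast, ← Real.rpow_add hr.1]
    congr 2; push_cast; ring
  · have i1 : IntegrableOn (fun r => H (x + r) * ρ ^ (-1 - 2 * s)) (Ici ρ) :=
      ((hH.comp_add_left x).mul_const _).integrableOn
    have i2 : IntegrableOn (fun r => H (x - r) * ρ ^ (-1 - 2 * s)) (Ici ρ) :=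
      ((hH.comp_sub_left x).mul_const _).integrableOn
    have i3 : IntegrableOn (fun r : ℝ => k * r ^ (-1 - 2 * s)) (Ici ρ) :=
by
      rw [integrableOn_Ici_iff_integrableOn_Ioi]
      exact (integrableOn_Ioi_rpow_of_lt (by linarith) hρ).const_mul k
    refine Integrable.mono' ((i1.add i2).add i3)
      (hF.mono_set (fun r hr => lt_of_lt_of_le hρ hr)) ?_
    filter_upwards [ae_restrict_mem measurableSet_Ici] with r hr
    have hr : ρ ≤ r := hr
    refine (h2 r hr).trans ?_
    have hle : r ^ (-1 - 2 * s) ≤ ρ ^ (-1 - 2 * s) :=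
      Real.rpow_le_rpow_of_nonpos hρ hr (by linarith)
    simp only [Pi.add_apply]
    nlinarith [hH0 (x + r), hH0 (x - r)]

lemma integrable_D_M {s x a : ℝ} (hs0 : 0 < s) (hs1 : s < 1) (hx : 0 < x) (hxa : x < a) :
    IntegrableOn (D s (M s a) x) (Ioi 0) := by
  obtain ⟨ρ, C, hρ, -, -, hC, hb⟩ := M_bounds (s := s) (b := a) hx hxa
  refine integrable_dom (x := x) (C := C) (k := 2 * M s a x) (H := M s a) hs0 hs1 hρ ?_ (integrable_M hs0 hs1 a)
    (M_nonneg s a) (by have := M_nonneg s a x; positivity) ?_ ?_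
  · apply Measurable.aestronglyMeasurable
    have := measurable_M_right s a
    unfold D; fun_prop
  · intro r hr0 hr
    have hp := Real.rpow_pos_of_pos hr0 (-1 - 2 * s)
    rw [D, abs_mul, abs_of_pos hp]
    exact mul_le_mul_of_nonneg_right (hb a ⟨le_rfl, le_rfl⟩ r hr0.le hr.le).1 hp.le
  · intro r hr
    have hp := Real.rpow_pos_of_pos (hρ.trans_le hr) (-1 - 2 * s)
    rw [D, abs_mul, abs_of_pos hp]
    apply mul_le_mul_of_nonneg_right _ hp.le
    have a1 := M_nonneg s a (x + r)
    have a2 := M_nonneg s a (x - r)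
    have a3 := M_nonneg s a x
    rw [abs_le]; constructor <;> linarith
end Stmt8Aux

namespace Stmt8Aux
open MeasureTheory Set Filter Topology

lemma tendsto_rpow_shift_nonneg {s c : ℝ} (hs0 : 0 < s) (hs1 : s < 1) (hc : 0 ≤ c) :
    Tendsto (fun Y : ℝ => (Y + c) ^ s - Y ^ s) atTop (𝓝 0) := by
  have h1 : Tendsto (fun Y : ℝ => s * c * Y ^ (-(1 - s))) atTop (𝓝 0) := by
    have := (tendsto_rpow_neg_atTop (y := 1 - s) (by linarith)).const_mul (s * c)
    simpa using this
  refine squeeze_zero' ?_ ?_ h1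
  · filter_upwards [eventually_gt_atTop 0] with Y hY
    have := Real.rpow_le_rpow hY.le (by linarith : Y ≤ Y + c) hs0.le
    linarith
  · filter_upwards [eventually_gt_atTop 0] with Y hY
    have hb := rpow_one_add_le_one_add_mul_self (s := c / Y) (by
      have : 0 ≤ c / Y := by positivity
      linarith) hs0.le hs1.le
    have e1 : (Y + c) ^ s = Y ^ s * (1 + c / Y) ^ s := by
      rw [← Real.mul_rpow hY.le (by positivity)]; congr 1; field_simp
    have e2 : Y ^ (-(1 - s)) = Y ^ s / Y := by
      rw [show -(1 - s) = s - 1 by ring, Real.rpow_sub_one hY.ne']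
    have hp := Real.rpow_pos_of_pos hY s
    rw [e1, e2]
    have := mul_le_mul_of_nonneg_left hb hp.le
    have e3 : Y ^ s * (1 + s * (c / Y)) = Y ^ s + s * c * (Y ^ s / Y) := by ring
    linarith

lemma tendsto_rpow_shift {s c : ℝ} (hs0 : 0 < s) (hs1 : s < 1) :
    Tendsto (fun Y : ℝ => (Y + c) ^ s - Y ^ s) atTop (𝓝 0) := by
  rcases le_total 0 c with h | h
  · exact tendsto_rpow_shift_nonneg hs0 hs1 h
  · have h1 := (tendsto_rpow_shift_nonneg hs0 hs1 (c := -c) (by linarith)).comp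
      (tendsto_atTop_add_const_right atTop c tendsto_id)
    have h2 := h1.neg
    rw [neg_zero] at h2
    refine h2.congr (fun Y => ?_)
    simp [Function.comp]

lemma tendsto_asym {s p q : ℝ} (hs0 : 0 < s) (hs1 : s < 1) (hp : 0 < p) (hq : 0 < q) :
    Tendsto (fun Q : ℝ => 2 * (Q ^ s * (Q - (p + q)) ^ s) - ((Q - p) ^ (2 * s) + (Q - q) ^ (2 * s)))
      atTop (𝓝 0) := by
  have hY : Tendsto (fun Q : ℝ => Q * (Q - (p + q))) atTop atTop := by
    apply Tendsto.atTop_mul_atTop₀ tendsto_id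
    exact tendsto_atTop_add_const_right atTop (-(p + q)) tendsto_id
  have h1 := ((tendsto_rpow_shift (c := p * q) hs0 hs1).comp hY).const_mul (-2)
  have h2 := (tendsto_rpow_shift (c := q - p) hs0 hs1).comp
    (tendsto_atTop_add_const_right atTop (-q) tendsto_id)
  have h3 := h1.sub (h2.mul h2)
  simp only [mul_zero, sub_zero] at h3
  refine h3.congr' ?_
  filter_upwards [eventually_gt_atTop (p + q)] with Q hQ
  simp only [Function.comp, id]
  have e1 : (Q * (Q - (p + q))) ^ s = Q ^ s * (Q - (p + q)) ^ s :=
    Real.mul_rpow (by linarith) (by linarith)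
  have e2 : (Q * (Q - (p + q)) + p * q) ^ s = (Q - p) ^ s * (Q - q) ^ s := by
    rw [← Real.mul_rpow (by linarith) (by linarith)]; congr 1; ring
  have e3 : Q + -q + (q - p) = Q - p := by ring
  have e4 : Q + -q = Q - q := by ring
  have e5 : (Q - p) ^ (2 * s) = (Q - p) ^ s * (Q - p) ^ s := by
    rw [← Real.rpow_add (by linarith)]; congr 1; ring
  have e6 : (Q - q) ^ (2 * s) = (Q - q) ^ s * (Q - q) ^ s := by
    rw [← Real.rpow_add (by linarith)]; congr 1; ring
  rw [e1, e2, e3, e4, e5, e6]; ring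

lemma subst_inv {c κ Q : ℝ} (hc : c < κ) (hQ : κ < Q) (g : ℝ → ℝ) :
    ∫ r in Ioo (Q - c)⁻¹ (κ - c)⁻¹, g r = ∫ τ in Ioo κ Q, ((τ - c) ^ 2)⁻¹ * g ((τ - c)⁻¹) := by
  have him : (fun τ : ℝ => (τ - c)⁻¹) '' Ioo κ Q = Ioo (Q - c)⁻¹ (κ - c)⁻¹ := by
    ext r
    constructor
    · rintro ⟨τ, ⟨h1, h2⟩, rfl⟩
      exact ⟨inv_strictAnti₀ (by linarith) (by linarith), inv_strictAnti₀ (by linarith) (by linarith)⟩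
    · rintro ⟨h1, h2⟩
      have hQ0 : 0 < (Q - c)⁻¹ := inv_pos.2 (by linarith)
      have hr : 0 < r := hQ0.trans h1
      refine ⟨r⁻¹ + c, ⟨?_, ?_⟩, by simp⟩
      · have := (lt_inv_comm₀ hr (by linarith)).1 h2; linarith
      · have := (inv_lt_comm₀ (by linarith) hr).1 h1; linarith
  rw [← him, integral_image_eq_integral_abs_deriv_smul (f' := fun τ => -((τ - c) ^ 2)⁻¹) measurableSet_Ioo]
  · apply setIntegral_congr_fun measurableSet_Ioo
    intro τ hτ
    simp only [smul_eq_mul, abs_neg]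
    rw [abs_of_nonneg (by positivity)]
  · intro τ hτ
    have hne : τ - c ≠ 0 := by have := hτ.1; intro h; linarith
    have := ((hasDerivAt_id τ).sub_const c).inv hne
    simp only [id] at this
    have e : -1 / (τ - c) ^ 2 = -((τ - c) ^ 2)⁻¹ := by rw [neg_div, one_div]
    rw [e] at this
    exact this.hasDerivWithinAt
  · intro a ha b hb hab
    have : a - c = b - c := inv_injective hab
    linarith

lemma left_val {s x a τ : ℝ} (hx : 0 < x) (hxa : x < a)
    (hτ : x⁻¹ + (a - x)⁻¹ < τ) :
    ((τ - (a - x)⁻¹) ^ 2)⁻¹ * (M s a (x - (τ - (a - x)⁻¹)⁻¹) * ((τ - (a - x)⁻¹)⁻¹) ^ (-1 - 2 * s))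
      = M s a x * ((τ - (x⁻¹ + (a - x)⁻¹)) ^ s * τ ^ (s - 1)) := by
  have hx' : 0 < x⁻¹ := inv_pos.2 hx
  have hax : 0 < a - x := by linarith
  have hax' : 0 < (a - x)⁻¹ := inv_pos.2 hax
  set q := (a - x)⁻¹ with hq
  set y := τ - q with hy
  have hy0 : 0 < y := by linarith
  have hτ0 : 0 < τ := by linarith
  have hyp : 0 < y - x⁻¹ := by linarith
  have e1 : x - y⁻¹ = x * (y - x⁻¹) / y := by field_simp
  have e2 : a - (x - y⁻¹) = (a - x) * τ / y := by
    have : τ = y + (a - x)⁻¹ := by rw [hy]; ring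
    rw [this]; field_simp; ring
  have n1 : 0 ≤ x - y⁻¹ := by rw [e1]; positivity
  have n2 : 0 ≤ a - (x - y⁻¹) := by rw [e2]; positivity
  rw [M_of_mem n1 (by linarith), M_of_mem hx.le hxa.le, e2, e1,
    show τ - (x⁻¹ + q) = y - x⁻¹ by rw [hy]; ring,
    Real.div_rpow (by positivity) hy0.le, Real.mul_rpow hx.le hyp.le,
    Real.div_rpow (by positivity) hy0.le, Real.mul_rpow hax.le hτ0.le,
    Real.inv_rpow hy0.le, ← Real.rpow_neg hy0.le, show -(-1 - 2 * s) = 1 + s + s by ring,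
    Real.rpow_add hy0, Real.rpow_add hy0, Real.rpow_one, Real.rpow_sub_one hy0.ne']
  have hY := Real.rpow_pos_of_pos hy0 s
  field_simp

lemma right_val {s x a τ : ℝ} (hx : 0 < x) (hxa : x < a)
    (hτ : x⁻¹ + (a - x)⁻¹ < τ) :
    ((τ - x⁻¹) ^ 2)⁻¹ * (M s a (x + (τ - x⁻¹)⁻¹) * ((τ - x⁻¹)⁻¹) ^ (-1 - 2 * s))
      = M s a x * (τ ^ s * (τ - (x⁻¹ + (a - x)⁻¹)) ^ (s - 1)) := by
  have hx' : 0 < x⁻¹ := inv_pos.2 hx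
  have hax : 0 < a - x := by linarith
  have hax' : 0 < (a - x)⁻¹ := inv_pos.2 hax
  set q := (a - x)⁻¹ with hq
  set y := τ - x⁻¹ with hy
  have hy0 : 0 < y := by linarith
  have hτ0 : 0 < τ := by linarith
  have hyp : 0 < y - q := by linarith
  have e1 : x + y⁻¹ = x * τ / y := by
    have : τ = y + x⁻¹ := by rw [hy]; ring
    rw [this]; field_simp
  have e2 : a - (x + y⁻¹) = (a - x) * (y - q) / y := by
    rw [hq]; field_simp; ring
  have n1 : 0 ≤ x + y⁻¹ := by rw [e1]; positivity
  have n2 : 0 ≤ a - (x + y⁻¹) := by rw [e2]; positivity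
  rw [M_of_mem n1 (by linarith), M_of_mem hx.le hxa.le, e2, e1,
    show τ - (x⁻¹ + q) = y - q by rw [hy]; ring,
    Real.div_rpow (by positivity) hy0.le, Real.mul_rpow hx.le hτ0.le,
    Real.div_rpow (by positivity) hy0.le, Real.mul_rpow hax.le hyp.le,
    Real.inv_rpow hy0.le, ← Real.rpow_neg hy0.le, show -(-1 - 2 * s) = 1 + s + s by ring,
    Real.rpow_add hy0, Real.rpow_add hy0, Real.rpow_one, Real.rpow_sub_one hy0.ne' s]
  have hY := Real.rpow_pos_of_pos hy0 s
  field_simp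

lemma ftc_part {s κ Q : ℝ} (hs0 : 0 < s) (hκ : 0 < κ) (hQ : κ < Q) :
    (∫ τ in Ioo κ Q, (τ - κ) ^ s * τ ^ (s - 1)) + (∫ τ in Ioo κ Q, τ ^ s * (τ - κ) ^ (s - 1))
      = s⁻¹ * (Q ^ s * (Q - κ) ^ s) := by
  have c1 : ∀ p : ℝ, ContinuousOn (fun τ : ℝ => τ ^ p) (Icc κ Q) := fun p =>
    ContinuousOn.rpow_const continuousOn_id (fun τ hτ => Or.inl ((hκ.trans_le hτ.1).ne'))
  have c2 : ContinuousOn (fun τ : ℝ => (τ - κ) ^ s) (Icc κ Q) :=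
    ContinuousOn.rpow_const (by fun_prop) (fun τ hτ => Or.inr hs0.le)
  have i1 : IntegrableOn (fun τ : ℝ => (τ - κ) ^ s * τ ^ (s - 1)) (Ioo κ Q) :=
    ((c2.mul (c1 (s - 1))).integrableOn_Icc).mono_set Ioo_subset_Icc_self
  have i2 : IntegrableOn (fun τ : ℝ => τ ^ s * (τ - κ) ^ (s - 1)) (Ioo κ Q) := by
    have j := (integrableOn_sub_right_rpow (p := s - 1) (by linarith) Q κ).const_mul (Q ^ s)
    refine Integrable.mono' j (Measurable.aestronglyMeasurable (by fun_prop)) ?_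
    filter_upwards [ae_restrict_mem measurableSet_Ioo] with τ hτ
    have h0 : 0 < τ := hκ.trans hτ.1
    have h1 : 0 < (τ - κ) ^ (s - 1) := Real.rpow_pos_of_pos (by linarith [hτ.1]) _
    have h2 : τ ^ s ≤ Q ^ s := Real.rpow_le_rpow h0.le hτ.2.le hs0.le
    rw [Real.norm_of_nonneg (by positivity)]
    exact mul_le_mul_of_nonneg_right h2 h1.le
  rw [← integral_add i1 i2]
  have h := intervalIntegral.integral_eq_sub_of_hasDerivAt_of_le (a := κ) (b := Q)
    (f := fun τ => s⁻¹ * (τ ^ s * (τ - κ) ^ s))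
    (f' := fun τ => (τ - κ) ^ s * τ ^ (s - 1) + τ ^ s * (τ - κ) ^ (s - 1)) hQ.le
    (by have := c1 s; fun_prop) ?_ ?_
  · rw [intervalIntegral.integral_of_le hQ.le, integral_Ioc_eq_integral_Ioo] at h
    rw [h, sub_self κ, Real.zero_rpow hs0.ne']; ring
  · intro τ hτ
    have h0 : 0 < τ := hκ.trans hτ.1
    have h1 : 0 < τ - κ := by linarith [hτ.1]
    have g1 := Real.hasDerivAt_rpow_const (x := τ) (p := s) (Or.inl h0.ne')
    have g2 := (Real.hasDerivAt_rpow_const (x := τ - κ) (p := s) (Or.inl h1.ne')).comp_sub_const τ κ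
    have g3 := (g1.mul g2).const_mul s⁻¹
    have e : s⁻¹ * (s * τ ^ (s - 1) * (τ - κ) ^ s + τ ^ s * (s * (τ - κ) ^ (s - 1)))
        = (τ - κ) ^ s * τ ^ (s - 1) + τ ^ s * (τ - κ) ^ (s - 1) := by field_simp
    rw [e] at g3
    exact g3
  · exact (intervalIntegrable_iff_integrableOn_Ioo_of_le hQ.le).2 (i1.add i2)
end Stmt8Aux

namespace Stmt8Aux
open MeasureTheory Set Filter Topology

lemma integrableOn_shift {s ε : ℝ} (hs0 : 0 < s) (hε : 0 < ε) {g : ℝ → ℝ} (hg : Integrable g) :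
    IntegrableOn (fun r => g r * r ^ (-1 - 2 * s)) (Ioi ε) := by
  refine Integrable.mono' ((hg.norm.mul_const (ε ^ (-1 - 2 * s))).integrableOn (s := Ioi ε)) ?_ ?_
  · exact hg.aestronglyMeasurable.restrict.mul (Measurable.aestronglyMeasurable (by fun_prop))
  · filter_upwards [ae_restrict_mem measurableSet_Ioi] with r hr
    have hr : ε < r := hr
    have hp := Real.rpow_pos_of_pos (hε.trans hr) (-1 - 2 * s)
    rw [norm_mul, Real.norm_of_nonneg hp.le]
    exact mul_le_mul_of_nonneg_left
      (Real.rpow_le_rpow_of_nonpos hε hr.le (by linarith)) (norm_nonneg _)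

lemma M_pv {s x a Q : ℝ} (hs0 : 0 < s) (hs1 : s < 1) (hx : 0 < x) (hxa : x < a)
    (hQ : x⁻¹ + (a - x)⁻¹ < Q) :
    (∫ r in Ioi (Q - (a - x)⁻¹)⁻¹, M s a (x - r) * r ^ (-1 - 2 * s))
      + (∫ r in Ioi (Q - x⁻¹)⁻¹, M s a (x + r) * r ^ (-1 - 2 * s))
      = M s a x * (s⁻¹ * (Q ^ s * (Q - (x⁻¹ + (a - x)⁻¹)) ^ s)) := by
  have hx' : 0 < x⁻¹ := inv_pos.2 hx
  have hax : 0 < a - x := by linarith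
  have hax' : 0 < (a - x)⁻¹ := inv_pos.2 hax
  set q := (a - x)⁻¹ with hq
  set κ := x⁻¹ + q with hκ
  rw [← ftc_part hs0 (by linarith : 0 < κ) hQ, mul_add]
  congr 1
  · have : ∫ r in Ioi (Q - q)⁻¹, M s a (x - r) * r ^ (-1 - 2 * s)
        = ∫ r in Ioo (Q - q)⁻¹ (κ - q)⁻¹, M s a (x - r) * r ^ (-1 - 2 * s) := by
      refine setIntegral_eq_of_subset_of_forall_sdiff_eq_zero measurableSet_Ioi Ioo_subset_Ioi_self ?_
      rintro r ⟨h1, h2⟩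
      have hk : (κ - q)⁻¹ = x := by rw [hκ]; simp
      rw [hk] at h2
      have : x ≤ r := by by_contra h; exact h2 ⟨h1, not_le.1 h⟩
      rw [M_of_nonpos hs0 (by linarith), zero_mul]
    rw [this, subst_inv (by linarith) hQ, ← integral_const_mul]
    apply setIntegral_congr_fun measurableSet_Ioo
    intro τ hτ
    exact left_val hx hxa hτ.1
  · have : ∫ r in Ioi (Q - x⁻¹)⁻¹, M s a (x + r) * r ^ (-1 - 2 * s)
        = ∫ r in Ioo (Q - x⁻¹)⁻¹ (κ - x⁻¹)⁻¹, M s a (x + r) * r ^ (-1 - 2 * s) := by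
      refine setIntegral_eq_of_subset_of_forall_sdiff_eq_zero measurableSet_Ioi Ioo_subset_Ioi_self ?_
      rintro r ⟨h1, h2⟩
      have hk : (κ - x⁻¹)⁻¹ = a - x := by rw [hκ, hq]; simp
      rw [hk] at h2
      have : a - x ≤ r := by by_contra h; exact h2 ⟨h1, not_le.1 h⟩
      rw [M_of_ge hs1 (by linarith), zero_mul]
    rw [this, subst_inv (by linarith) hQ, ← integral_const_mul]
    apply setIntegral_congr_fun measurableSet_Ioo
    intro τ hτ
    exact right_val hx hxa hτ.1

lemma sol_M {s x a : ℝ} (hs0 : 0 < s) (hs1 : s < 1) (hx : 0 < x) (hxa : x < a) :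
    Sol s (M s a) x := by
  have hint := integrable_D_M hs0 hs1 hx hxa
  refine ⟨hint, ?_⟩
  obtain ⟨ρ, C, hρ, -, -, hC, hb⟩ := M_bounds (s := s) (b := a) hx hxa
  have hb : ∀ r, 0 ≤ r → r ≤ ρ → |M s a (x + r) - M s a x| ≤ C * r :=
    fun r h1 h2 => (hb a ⟨le_rfl, le_rfl⟩ r h1 h2).2
  have hx' : 0 < x⁻¹ := inv_pos.2 hx
  have hax : 0 < a - x := by linarith
  have hax' : 0 < (a - x)⁻¹ := inv_pos.2 hax
  set p := x⁻¹ with hp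
  set q := (a - x)⁻¹ with hq
  set m := M s a x with hm
  have hMi := integrable_M hs0 hs1 a
  have hlim0 : Tendsto (fun Q : ℝ => (Q - q)⁻¹) atTop (𝓝 0) :=
    tendsto_inv_atTop_zero.comp (tendsto_atTop_add_const_right atTop (-q) tendsto_id)
  have hlim1 : Tendsto (fun Q : ℝ => ∫ r in Ioi (Q - q)⁻¹, D s (M s a) x r) atTop
      (𝓝 (∫ r in Ioi 0, D s (M s a) x r)) := by
    have hc := (aecover_Ioi_of_Ioi (μ := (volume : Measure ℝ)) hlim0)
    have := hc.integral_tendsto_of_countably_generated hint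
    refine this.congr' ?_
    filter_upwards [eventually_gt_atTop q] with Q hQ
    have : 0 < (Q - q)⁻¹ := inv_pos.2 (by linarith)
    rw [Measure.restrict_restrict measurableSet_Ioi, Ioi_inter_Ioi, sup_of_le_left this.le]
  -- main decomposition
  have hdec : ∀ᶠ Q : ℝ in atTop, ‖(∫ r in Ioi (Q - q)⁻¹, D s (M s a) x r)
      - m / (2 * s) * (2 * (Q ^ s * (Q - (p + q)) ^ s) - ((Q - p) ^ (2 * s) + (Q - q) ^ (2 * s)))‖
      ≤ C * |p - q| * (Q ^ (2 * s) * ((Q - (p + q)) ^ 2)⁻¹) := by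
    have hlim2 : Tendsto (fun Q : ℝ => (Q - (p + q))⁻¹) atTop (𝓝 0) :=
      tendsto_inv_atTop_zero.comp (tendsto_atTop_add_const_right atTop (-(p + q)) tendsto_id)
    filter_upwards [eventually_gt_atTop (p + q), hlim2.eventually (gt_mem_nhds hρ)] with Q hQ hQρ
    have hQq : 0 < Q - q := by linarith
    have hQp : 0 < Q - p := by linarith
    have hQk : 0 < Q - (p + q) := by linarith
    have hQ0 : 0 < Q := by linarith
    set e1 := (Q - q)⁻¹ with he1
    set e2 := (Q - p)⁻¹ with he2
    have he1p : 0 < e1 := inv_pos.2 hQq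
    have he2p : 0 < e2 := inv_pos.2 hQp
    have iA : IntegrableOn (fun r => M s a (x - r) * r ^ (-1 - 2 * s)) (Ioi e1) :=
      integrableOn_shift hs0 he1p (hMi.comp_sub_left x)
    have iB : ∀ e, 0 < e → IntegrableOn (fun r => M s a (x + r) * r ^ (-1 - 2 * s)) (Ioi e) :=
      fun e he => integrableOn_shift hs0 he (hMi.comp_add_left x)
    have iK : ∀ e, 0 < e → IntegrableOn (fun r : ℝ => m * r ^ (-1 - 2 * s)) (Ioi e) :=
      fun e he => (integrableOn_Ioi_rpow_of_lt (by linarith) he).const_mul m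
    have vK : ∀ y, 0 < y → ∫ r in Ioi y⁻¹, m * r ^ (-1 - 2 * s) = m / (2 * s) * y ^ (2 * s) := by
      intro y hy
      rw [integral_const_mul, integral_Ioi_rpow_of_lt (by linarith) (inv_pos.2 hy),
        show -1 - 2 * s + 1 = -(2 * s) by ring, neg_div_neg_eq, Real.rpow_neg (inv_pos.2 hy).le,
        Real.inv_rpow hy.le, inv_inv]
      ring
    have i5 : ∀ e, 0 < e → IntegrableOn (fun r => (M s a (x + r) - m) * r ^ (-1 - 2 * s)) (Ioi e) := by
      intro e he
      refine ((iB e he).sub (iK e he)).congr_fun (fun r hr => ?_) measurableSet_Ioi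
      simp only [Pi.sub_apply]; ring
    have v5 : ∀ e, 0 < e → ∫ r in Ioi e, (M s a (x + r) - m) * r ^ (-1 - 2 * s)
        = (∫ r in Ioi e, M s a (x + r) * r ^ (-1 - 2 * s)) - ∫ r in Ioi e, m * r ^ (-1 - 2 * s) := by
      intro e he
      rw [← integral_sub (iB e he) (iK e he)]
      congr 1; funext r; ring
    have vD : ∫ r in Ioi e1, D s (M s a) x r
        = (∫ r in Ioi e1, M s a (x - r) * r ^ (-1 - 2 * s)) - (∫ r in Ioi e1, m * r ^ (-1 - 2 * s))
          + ∫ r in Ioi e1, (M s a (x + r) - m) * r ^ (-1 - 2 * s) := by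
      have iAK : IntegrableOn (fun r => M s a (x - r) * r ^ (-1 - 2 * s)
          - m * r ^ (-1 - 2 * s)) (Ioi e1) := iA.sub (iK e1 he1p)
      rw [← integral_sub iA (iK e1 he1p), ← integral_add iAK (i5 e1 he1p)]
      congr 1; funext r; simp only [D]; ring
    have vE : (∫ r in Ioi e1, (M s a (x + r) - m) * r ^ (-1 - 2 * s))
        - (∫ r in Ioi e2, (M s a (x + r) - m) * r ^ (-1 - 2 * s))
        = ∫ r in e1..e2, (M s a (x + r) - m) * r ^ (-1 - 2 * s) :=
      intervalIntegral.integral_Ioi_sub_Ioi' (i5 e1 he1p) (i5 e2 he2p)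
    have hpv := M_pv hs0 hs1 hx hxa hQ
    rw [← hp, ← hq, ← hm] at hpv
    have hval : (∫ r in Ioi e1, D s (M s a) x r)
      - m / (2 * s) * (2 * (Q ^ s * (Q - (p + q)) ^ s) - ((Q - p) ^ (2 * s) + (Q - q) ^ (2 * s)))
      = ∫ r in e1..e2, (M s a (x + r) - m) * r ^ (-1 - 2 * s) := by
      have h2 := v5 e2 he2p
      have h3 := vK _ hQq
      have h4 := vK _ hQp
      rw [← he1] at h3
      rw [← he2] at h4
      have h5 : m * (s⁻¹ * (Q ^ s * (Q - (p + q)) ^ s)) = m / (2 * s) * (2 * (Q ^ s * (Q - (p + q)) ^ s)) := by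
        field_simp
      rw [h5] at hpv
      rw [vD, ← vE, h2, h3, h4]
      linear_combination hpv
    rw [hval]
    have hbd : ∀ r ∈ uIoc e1 e2, ‖(M s a (x + r) - m) * r ^ (-1 - 2 * s)‖ ≤ C * Q ^ (2 * s) := by
      intro r hr
      have hr1 : Q⁻¹ ≤ r := by
        have h1 : Q⁻¹ ≤ e1 := inv_anti₀ hQq (by linarith)
        have h2 : Q⁻¹ ≤ e2 := inv_anti₀ hQp (by linarith)
        exact (le_min h1 h2).trans hr.1.le
      have hr2 : r ≤ ρ := by
        have h1 : e1 ≤ (Q - (p + q))⁻¹ := inv_anti₀ hQk (by linarith)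
        have h2 : e2 ≤ (Q - (p + q))⁻¹ := inv_anti₀ hQk (by linarith)
        exact hr.2.trans ((max_le h1 h2).trans hQρ.le)
      have hQi : 0 < Q⁻¹ := inv_pos.2 hQ0
      have hr0 : 0 < r := hQi.trans_le hr1
      rw [norm_mul, Real.norm_eq_abs, Real.norm_of_nonneg (Real.rpow_nonneg hr0.le _)]
      calc |M s a (x + r) - m| * r ^ (-1 - 2 * s) ≤ (C * r) * r ^ (-1 - 2 * s) :=
            mul_le_mul_of_nonneg_right (hb r hr0.le hr2) (Real.rpow_nonneg hr0.le _)
        _ = C * r ^ (-(2 * s)) := by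
            rw [mul_assoc]; congr 1
            nth_rewrite 1 [← Real.rpow_one r]
            rw [← Real.rpow_add hr0]; congr 1; ring
        _ ≤ C * (Q⁻¹) ^ (-(2 * s)) := by
            apply mul_le_mul_of_nonneg_left _ hC
            exact Real.rpow_le_rpow_of_nonpos hQi hr1 (by linarith)
        _ = C * Q ^ (2 * s) := by
            rw [Real.inv_rpow hQ0.le, Real.rpow_neg hQ0.le, inv_inv]
    refine (intervalIntegral.norm_integral_le_of_norm_le_const hbd).trans ?_
    have h6 : |e2 - e1| ≤ |p - q| * ((Q - (p + q)) ^ 2)⁻¹ := by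
      have : e2 - e1 = (p - q) * ((Q - p) * (Q - q))⁻¹ := by
        rw [he1, he2]; field_simp; ring
      rw [this, abs_mul, abs_of_pos (a := ((Q - p) * (Q - q))⁻¹) (by positivity)]
      apply mul_le_mul_of_nonneg_left _ (abs_nonneg _)
      apply inv_anti₀ (by positivity)
      rw [sq]
      exact mul_le_mul (by linarith) (by linarith) hQk.le hQp.le
    calc C * Q ^ (2 * s) * |e2 - e1| ≤ C * Q ^ (2 * s) * (|p - q| * ((Q - (p + q)) ^ 2)⁻¹) :=
          mul_le_mul_of_nonneg_left h6 (by positivity)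
      _ = _ := by ring
  have hE : Tendsto (fun Q : ℝ => C * |p - q| * (Q ^ (2 * s) * ((Q - (p + q)) ^ 2)⁻¹)) atTop (𝓝 0) := by
    have t1 : Tendsto (fun Q : ℝ => C * |p - q| * (4 * Q ^ (-(2 - 2 * s)))) atTop (𝓝 0) := by
      have := ((tendsto_rpow_neg_atTop (y := 2 - 2 * s) (by linarith)).const_mul 4).const_mul (C * |p - q|)
      simpa using this
    refine squeeze_zero' ?_ ?_ t1
    · filter_upwards [eventually_gt_atTop 0] with Q hQ
      positivity
    · filter_upwards [eventually_gt_atTop 0, eventually_gt_atTop (2 * (p + q))] with Q hQ hQ2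
      apply mul_le_mul_of_nonneg_left _ (by positivity)
      have h1 : ((Q - (p + q)) ^ 2)⁻¹ ≤ 4 * (Q ^ 2)⁻¹ := by
        have : ((Q / 2) ^ 2)⁻¹ = 4 * (Q ^ 2)⁻¹ := by field_simp; norm_num
        rw [← this]
        apply inv_anti₀ (by positivity)
        apply pow_le_pow_left₀ (by positivity); linarith
      have h2 : Q ^ (-(2 - 2 * s)) = Q ^ (2 * s) * (Q ^ 2)⁻¹ := by
        rw [show -(2 - 2 * s) = 2 * s - (2 : ℕ) by push_cast; ring, Real.rpow_sub_natCast hQ.ne', div_eq_mul_inv]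
      rw [h2]
      have := mul_le_mul_of_nonneg_left h1 (Real.rpow_nonneg hQ.le (2 * s))
      linarith
  have hT := (tendsto_asym hs0 hs1 hx' hax').const_mul (m / (2 * s))
  rw [mul_zero] at hT
  have h7 := squeeze_zero_norm' hdec hE
  have h8 := h7.add hT
  simp only [sub_add_cancel, add_zero] at h8
  exact tendsto_nhds_unique hlim1 h8
end Stmt8Aux

namespace Stmt8Aux
open MeasureTheory Set Filter Topology

noncomputable def c0 (s : ℝ) : ℝ := ∫ θ in (0:ℝ)..1, (1 - θ) ^ (-s) * θ ^ (s - 1)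

lemma c0_pos {s : ℝ} (hs0 : 0 < s) (hs1 : s < 1) : 0 < c0 s := by
  apply intervalIntegral.intervalIntegral_pos_of_pos_on _ _ one_pos
  · have := integrableOn_beta hs0 hs1 0 1
    simp only [sub_zero] at this
    exact (intervalIntegrable_iff_integrableOn_Ioo_of_le zero_le_one).2 this
  · intro x hx
    have := Real.rpow_pos_of_pos (sub_pos.2 hx.2) (-s)
    have := Real.rpow_pos_of_pos hx.1 (s - 1)
    positivity

lemma beta_val {s : ℝ} {z b : ℝ} (hzb : z < b) :
    ∫ a in Ioo z b, (b - a) ^ (-s) * (a - z) ^ (s - 1) = c0 s := by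
  rw [← integral_Ioc_eq_integral_Ioo, ← intervalIntegral.integral_of_le hzb.le]
  have h := intervalIntegral.smul_integral_comp_add_mul
    (f := fun a : ℝ => (b - a) ^ (-s) * (a - z) ^ (s - 1)) (a := 0) (b := 1) (b - z) z
  rw [show z + (b - z) * 0 = z by ring, show z + (b - z) * 1 = b by ring] at h
  rw [← h, ← intervalIntegral.integral_smul]
  unfold c0
  apply intervalIntegral.integral_congr
  intro θ hθ
  rw [uIcc_of_le zero_le_one] at hθ
  have hd : 0 < b - z := by linarith
  simp only [smul_eq_mul]
  rw [show b - (z + (b - z) * θ) = (b - z) * (1 - θ) by ring,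
    show z + (b - z) * θ - z = (b - z) * θ by ring,
    Real.mul_rpow hd.le (by linarith [hθ.2]), Real.mul_rpow hd.le hθ.1]
  have : (b - z) * ((b - z) ^ (-s) * (b - z) ^ (s - 1)) = 1 := by
    rw [← Real.rpow_add hd, show -s + (s - 1) = -1 by ring, Real.rpow_neg_one]
    field_simp
  linear_combination ((1 - θ) ^ (-s) * θ ^ (s - 1)) * this

lemma g_int {s : ℝ} (hs0 : 0 < s) (hs1 : s < 1) (R b z : ℝ) :
    IntegrableOn (fun a => (b - a) ^ (-s) * M s a z) (Ioo R b) := by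
  rcases le_or_gt z 0 with hz | hz
  · simp only [M_of_nonpos hs0 hz, mul_zero]
    exact integrableOn_zero
  have h1 : IntegrableOn (fun a => (b - a) ^ (-s) * M s a z) (Ioo z b) := by
    refine IntegrableOn.congr_fun ((integrableOn_beta hs0 hs1 z b).const_mul (z ^ s)) ?_ measurableSet_Ioo
    intro a ha
    simp only
    rw [M_of_mem hz.le ha.1.le]; ring
  have h2 : IntegrableOn (fun a => (b - a) ^ (-s) * M s a z) (Iio b) := by
    refine h1.of_forall_sdiff_eq_zero measurableSet_Iio ?_
    intro a ha
    have : a ≤ z := by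
      by_contra h
      exact ha.2 ⟨not_le.1 h, ha.1⟩
    rw [M_of_ge hs1 this, mul_zero]
  exact h2.mono_set Ioo_subset_Iio_self

noncomputable def G (s R b z : ℝ) : ℝ := ∫ a in Ioo R b, (b - a) ^ (-s) * M s a z

lemma G_nonneg (s R b z : ℝ) : 0 ≤ G s R b z := by
  apply setIntegral_nonneg measurableSet_Ioo
  intro a ha
  exact mul_nonneg (Real.rpow_nonneg (by linarith [ha.2]) _) (M_nonneg _ _ _)

lemma G_of_nonpos {s : ℝ} (hs0 : 0 < s) {R b z : ℝ} (hz : z ≤ 0) : G s R b z = 0 := by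
  unfold G
  simp only [M_of_nonpos hs0 hz, mul_zero, integral_zero]

lemma G_of_ge {s : ℝ} (hs1 : s < 1) {R b z : ℝ} (hz : b ≤ z) : G s R b z = 0 := by
  unfold G
  apply setIntegral_eq_zero_of_forall_eq_zero
  intro a ha
  rw [M_of_ge hs1 (ha.2.le.trans hz), mul_zero]

lemma G_of_mem {s : ℝ} (hs1 : s < 1) {R b z : ℝ} (hR : 0 < R) (hz : R ≤ z) (hzb : z < b) :
    G s R b z = z ^ s * c0 s := by
  unfold G
  rw [← beta_val (s := s) hzb, ← integral_const_mul,
    setIntegral_eq_of_subset_of_forall_sdiff_eq_zero measurableSet_Ioo (Ioo_subset_Ioo_left hz)]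
  · apply setIntegral_congr_fun measurableSet_Ioo
    intro a ha
    simp only
    rw [M_of_mem (hR.le.trans hz) ha.1.le]; ring
  · intro a ha
    have : a ≤ z := by
      by_contra h
      exact ha.2 ⟨not_le.1 h, ha.1.2⟩
    rw [M_of_ge hs1 this, mul_zero]

lemma g_bound {s : ℝ} (hs0 : 0 < s) (hs1 : s < 1) {R b z a : ℝ} (hz0 : 0 ≤ z) (hz : z ≤ R)
    (ha : a ∈ Ioo R b) :
    (b - a) ^ (-s) * M s a z ≤ R ^ s * ((b - a) ^ (-s) * (a - R) ^ (s - 1)) := by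
  rw [M_of_mem hz0 (hz.trans ha.1.le)]
  have h1 : z ^ s ≤ R ^ s := Real.rpow_le_rpow hz0 hz hs0.le
  have h2 : (a - z) ^ (s - 1) ≤ (a - R) ^ (s - 1) :=
    Real.rpow_le_rpow_of_nonpos (by linarith [ha.1]) (by linarith) (by linarith)
  have h3 : z ^ s * (a - z) ^ (s - 1) ≤ R ^ s * (a - R) ^ (s - 1) :=
    mul_le_mul h1 h2 (Real.rpow_nonneg (by linarith [ha.1]) _) (Real.rpow_nonneg (hz0.trans hz) _)
  have h4 : 0 ≤ (b - a) ^ (-s) := Real.rpow_nonneg (by linarith [ha.2]) _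
  calc _ ≤ (b - a) ^ (-s) * (R ^ s * (a - R) ^ (s - 1)) := mul_le_mul_of_nonneg_left h3 h4
    _ = _ := by ring

lemma G_le {s : ℝ} (hs0 : 0 < s) (hs1 : s < 1) {R b : ℝ} (hR : 0 < R) (hb : R < b) (z : ℝ) :
    G s R b z ≤ b ^ s * c0 s := by
  have hc := c0_pos hs0 hs1
  have hb0 : 0 < b := hR.trans hb
  have hp : 0 ≤ b ^ s * c0 s := by positivity
  rcases le_or_gt z 0 with hz | hz
  · rw [G_of_nonpos hs0 hz]; exact hp
  rcases le_or_gt b z with hz2 | hz2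
  · rw [G_of_ge hs1 hz2]; exact hp
  rcases le_or_gt R z with hz3 | hz3
  · rw [G_of_mem hs1 hR hz3 hz2]
    exact mul_le_mul_of_nonneg_right (Real.rpow_le_rpow hz.le hz2.le hs0.le) hc.le
  calc G s R b z ≤ ∫ a in Ioo R b, R ^ s * ((b - a) ^ (-s) * (a - R) ^ (s - 1)) :=
        setIntegral_mono_on (g_int hs0 hs1 R b z) ((integrableOn_beta hs0 hs1 R b).const_mul _)
          measurableSet_Ioo (fun a ha => g_bound hs0 hs1 hz.le hz3.le ha)
    _ = R ^ s * c0 s := by rw [integral_const_mul, beta_val hb]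
    _ ≤ _ := mul_le_mul_of_nonneg_right (Real.rpow_le_rpow hR.le hb.le hs0.le) hc.le

lemma measurable_G (s R b : ℝ) : Measurable (G s R b) := by
  have : StronglyMeasurable (fun p : ℝ × ℝ => (b - p.2) ^ (-s) * M s p.2 p.1) := by
    apply Measurable.stronglyMeasurable
    unfold M; fun_prop
  exact (this.integral_prod_right' (ν := volume.restrict (Ioo R b))).measurable

lemma integrable_G {s : ℝ} (hs0 : 0 < s) (hs1 : s < 1) {R b : ℝ} (hR : 0 < R) (hb : R < b) :
    Integrable (G s R b) := by
  have : IntegrableOn (G s R b) (Ioo 0 b) := by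
    refine Integrable.mono' (g := fun _ => b ^ s * c0 s) (integrable_const _)
      (measurable_G s R b).aestronglyMeasurable (Eventually.of_forall fun z => ?_)
    rw [Real.norm_of_nonneg (G_nonneg _ _ _ _)]
    exact G_le hs0 hs1 hR hb z
  refine this.integrable_of_ae_notMem_eq_zero (Eventually.of_forall ?_)
  intro z hz
  rcases le_or_gt z 0 with hz1 | hz1
  · exact G_of_nonpos hs0 hz1
  · apply G_of_ge hs1
    by_contra h
    exact hz ⟨hz1, not_le.1 h⟩

lemma continuousOn_G {s : ℝ} (hs0 : 0 < s) (hs1 : s < 1) {R b : ℝ} :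
    ContinuousOn (G s R b) (Icc 0 R) := by
  unfold G
  refine continuousOn_of_dominated
    (bound := fun a => R ^ s * ((b - a) ^ (-s) * (a - R) ^ (s - 1))) ?_ ?_ ?_ ?_
  · intro z _
    apply Measurable.aestronglyMeasurable
    unfold M; fun_prop
  · intro z hz
    filter_upwards [ae_restrict_mem measurableSet_Ioo] with a ha
    rw [Real.norm_of_nonneg (mul_nonneg (Real.rpow_nonneg (by linarith [ha.2]) _) (M_nonneg _ _ _))]
    exact g_bound hs0 hs1 hz.1 hz.2 ha
  · exact (integrableOn_beta hs0 hs1 R b).const_mul _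
  · filter_upwards [ae_restrict_mem measurableSet_Ioo] with a ha
    intro z hz
    apply ContinuousAt.continuousWithinAt
    have hne : max (a - z) 0 ≠ 0 := by
      have h1 : 0 < a - z := by linarith [hz.2, ha.1]
      have := le_max_left (a - z) 0
      linarith
    unfold M
    refine ContinuousAt.mul continuousAt_const (ContinuousAt.mul ?_ ?_)
    · exact ContinuousAt.rpow_const (by fun_prop) (Or.inr hs0.le)
    · exact ContinuousAt.rpow_const (by fun_prop) (Or.inl hne)

lemma sol_G {s : ℝ} (hs0 : 0 < s) (hs1 : s < 1) {R b x : ℝ} (hb : R < b) (hx : 0 < x)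
    (hxR : x < R) : Sol s (G s R b) x := by
  have hR : 0 < R := hx.trans hxR
  set μ := volume.restrict (Ioi (0:ℝ)) with hμ
  set ν := volume.restrict (Ioo R b) with hν
  set Φ : ℝ → ℝ → ℝ := fun r a => (b - a) ^ (-s) * D s (M s a) x r with hΦ
  have hmeas : Measurable (Function.uncurry Φ) := by
    simp only [hΦ, Function.uncurry_def, D, M]
    fun_prop
  have e1 : ∀ r, Φ r = fun a => ((b - a) ^ (-s) * M s a (x + r) + (b - a) ^ (-s) * M s a (x - r)
      - 2 * ((b - a) ^ (-s) * M s a x)) * r ^ (-1 - 2 * s) := by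
    intro r; funext a; simp only [hΦ, D]; ring
  have i1 : ∀ r, Integrable (Φ r) ν := by
    intro r
    rw [e1]
    exact ((((g_int hs0 hs1 R b (x + r)).add (g_int hs0 hs1 R b (x - r))).sub
      ((g_int hs0 hs1 R b x).const_mul 2))).mul_const _
  have v1 : ∀ r, ∫ a, Φ r a ∂ν = D s (G s R b) x r := by
    intro r
    rw [e1, integral_mul_const]
    have j1 := g_int hs0 hs1 R b (x + r)
    have j2 := g_int hs0 hs1 R b (x - r)
    have j3 := (g_int hs0 hs1 R b x).const_mul 2
    have j4 : IntegrableOn (fun a => (b - a) ^ (-s) * M s a (x + r)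
      + (b - a) ^ (-s) * M s a (x - r)) (Ioo R b) := j1.add j2
    rw [integral_sub j4 j3, integral_add j1 j2, integral_const_mul]
    rfl
  have hw : IntegrableOn (fun a : ℝ => (b - a) ^ (-s)) (Ioo R b) :=
    integrableOn_sub_left_rpow (by linarith) b R
  obtain ⟨ρ, C, hρ, -, -, hC, hbd⟩ := M_bounds (s := s) (b := b) hx hxR
  have i2 : Integrable (fun r => ∫ a, ‖Φ r a‖ ∂ν) μ := by
    refine integrable_dom (x := x) (C := C * ∫ a, (b - a) ^ (-s) ∂ν) (k := 2 * G s R b x)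
      (H := G s R b) hs0 hs1 hρ ?_ (integrable_G hs0 hs1 hR hb) (G_nonneg s R b)
      (by have := G_nonneg s R b x; positivity) ?_ ?_
    · exact (hmeas.norm.stronglyMeasurable.integral_prod_right' (ν := ν)).aestronglyMeasurable
    · intro r hr0 hr
      rw [abs_of_nonneg (integral_nonneg fun a => norm_nonneg _)]
      have hp := Real.rpow_pos_of_pos hr0 (-1 - 2 * s)
      calc ∫ a, ‖Φ r a‖ ∂ν ≤ ∫ a, (b - a) ^ (-s) * (C * r ^ 2 * r ^ (-1 - 2 * s)) ∂ν := by
            refine integral_mono_ae (i1 r).norm (hw.mul_const _) ?_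
            filter_upwards [ae_restrict_mem measurableSet_Ioo] with a ha
            have h4 : 0 ≤ (b - a) ^ (-s) := Real.rpow_nonneg (by linarith [ha.2]) _
            simp only [hΦ, D]
            rw [norm_mul, norm_mul, Real.norm_of_nonneg h4, Real.norm_of_nonneg hp.le]
            exact mul_le_mul_of_nonneg_left (mul_le_mul_of_nonneg_right
              (hbd a (Ioo_subset_Icc_self ha) r hr0.le hr.le).1 hp.le) h4
        _ = _ := by rw [integral_mul_const]; ring
    · intro r hr
      have hr0 : 0 < r := hρ.trans_le hr
      rw [abs_of_nonneg (integral_nonneg fun a => norm_nonneg _)]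
      have hp := Real.rpow_pos_of_pos hr0 (-1 - 2 * s)
      have j1 := g_int hs0 hs1 R b (x + r)
      have j2 := g_int hs0 hs1 R b (x - r)
      have j3 := (g_int hs0 hs1 R b x).const_mul 2
      have j4 : IntegrableOn (fun a => (b - a) ^ (-s) * M s a (x + r)
        + (b - a) ^ (-s) * M s a (x - r)) (Ioo R b) := j1.add j2
      have j5 : IntegrableOn (fun a => (b - a) ^ (-s) * M s a (x + r)
        + (b - a) ^ (-s) * M s a (x - r) + 2 * ((b - a) ^ (-s) * M s a x)) (Ioo R b) := j4.add j3
      calc ∫ a, ‖Φ r a‖ ∂ν ≤ ∫ a, ((b - a) ^ (-s) * M s a (x + r)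
            + (b - a) ^ (-s) * M s a (x - r) + 2 * ((b - a) ^ (-s) * M s a x)) * r ^ (-1 - 2 * s) ∂ν := by
            refine integral_mono_ae (i1 r).norm (j5.mul_const _) ?_
            filter_upwards [ae_restrict_mem measurableSet_Ioo] with a ha
            have h4 : 0 ≤ (b - a) ^ (-s) := Real.rpow_nonneg (by linarith [ha.2]) _
            rw [e1]
            simp only
            rw [norm_mul, Real.norm_of_nonneg hp.le]
            apply mul_le_mul_of_nonneg_right _ hp.le
            have k1 := mul_nonneg h4 (M_nonneg s a (x + r))
            have k2 := mul_nonneg h4 (M_nonneg s a (x - r))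
            have k3 := mul_nonneg h4 (M_nonneg s a x)
            rw [Real.norm_eq_abs, abs_le]
            constructor <;> linarith
        _ = _ := by
            rw [integral_mul_const, integral_add j4 j3, integral_add j1 j2, integral_const_mul]
            rfl
  have hprod : Integrable (Function.uncurry Φ) (μ.prod ν) := by
    rw [integrable_prod_iff hmeas.aestronglyMeasurable]
    exact ⟨Eventually.of_forall fun r => i1 r, i2⟩
  constructor
  · have := hprod.integral_prod_left
    simp only [Function.uncurry_apply_pair] at this
    simp only [v1] at this
    exact this
  · have := integral_integral_swap hprod
    simp only [v1] at this
    rw [← hμ, this]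
    apply integral_eq_zero_of_ae
    filter_upwards [ae_restrict_mem measurableSet_Ioo] with a ha
    simp only [hΦ]
    rw [integral_const_mul, (sol_M hs0 hs1 hx (hxR.trans ha.1)).2, mul_zero]
    rfl

end Stmt8Aux

namespace Stmt8Aux
open MeasureTheory Set Filter Topology

noncomputable def P (s R x t : ℝ) : ℝ := (R - x) ^ s * (t - R) ^ (-s) / (t - x)

lemma P_nonneg {s R x t : ℝ} (hxR : x < R) (ht : R ≤ t) : 0 ≤ P s R x t := by
  unfold P
  apply div_nonneg (mul_nonneg (Real.rpow_nonneg (by linarith) _) (Real.rpow_nonneg (by linarith) _))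
  linarith

lemma measurable_P (s R x : ℝ) : Measurable (P s R x) := by
  unfold P; fun_prop

lemma G_formula_set {s : ℝ} {R b x : ℝ} (hb : R < b) (hx : 0 < x)
    (hxR : x < R) : G s R b x = x ^ s * ∫ t in Ioo R b, P s R x t := by
  have hB : 0 < b - x := by linarith
  have hQ : 0 < R - x := by linarith
  set φ : ℝ → ℝ := fun t => x + (b - x) * (R - x) / (t - x) with hφ
  have hmaps : ∀ t ∈ Ioo R b, φ t ∈ Ioo R b := by
    intro t ht
    have h1 : 0 < t - x := by linarith [ht.1]
    constructor
    · have : R - x < (b - x) * (R - x) / (t - x) := by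
        rw [lt_div_iff₀ h1]; nlinarith [ht.2]
      simp only [hφ]; linarith
    · have : (b - x) * (R - x) / (t - x) < b - x := by
        rw [div_lt_iff₀ h1]; nlinarith [ht.1]
      simp only [hφ]; linarith
  have hinv : ∀ t ∈ Ioo R b, φ (φ t) = t := by
    intro t ht
    have h1 : t - x ≠ 0 := by have := ht.1; intro h; linarith
    simp only [hφ]
    rw [add_sub_cancel_left]
    field_simp
    ring
  have himg : φ '' Ioo R b = Ioo R b := by
    apply Subset.antisymm
    · rintro _ ⟨t, ht, rfl⟩; exact hmaps t ht
    · intro t ht; exact ⟨φ t, hmaps t ht, hinv t ht⟩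
  have hinj : InjOn φ (Ioo R b) := fun t ht t' ht' h => by
    rw [← hinv t ht, ← hinv t' ht', h]
  have hder : ∀ t ∈ Ioo R b, HasDerivWithinAt φ (-((b - x) * (R - x)) / (t - x) ^ 2) (Ioo R b) t := by
    intro t ht
    have h1 : t - x ≠ 0 := by have := ht.1; intro h; linarith
    have h2 : HasDerivAt (fun t => t - x) 1 t := (hasDerivAt_id t).sub_const x
    have h3 := ((hasDerivAt_const t ((b - x) * (R - x))).div h2 h1).const_add x
    rw [show (0 * (t - x) - (b - x) * (R - x) * 1) / (t - x) ^ 2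
      = -((b - x) * (R - x)) / (t - x) ^ 2 by ring] at h3
    exact h3.hasDerivWithinAt
  have key := integral_image_eq_integral_abs_deriv_smul measurableSet_Ioo hder hinj
    (fun a => (b - a) ^ (-s) * M s a x)
  rw [himg] at key
  unfold G
  rw [key, ← integral_const_mul]
  apply setIntegral_congr_fun measurableSet_Ioo
  intro t ht
  have h1 : 0 < t - x := by linarith [ht.1]
  have h2 : 0 < t - R := by linarith [ht.1]
  simp only [smul_eq_mul]
  rw [M_of_mem hx.le (by linarith [(hmaps t ht).1])]
  have e1 : b - φ t = (b - x) * (t - R) * (t - x)⁻¹ := by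
    simp only [hφ]; field_simp; ring
  have e2 : φ t - x = (b - x) * (R - x) * (t - x)⁻¹ := by
    simp only [hφ]; field_simp; ring
  have hi : 0 < (t - x)⁻¹ := inv_pos.2 h1
  rw [e1, e2, Real.mul_rpow (by positivity) hi.le, Real.mul_rpow hB.le h2.le,
    Real.mul_rpow (by positivity) hi.le, Real.mul_rpow hB.le hQ.le, abs_div, abs_neg,
    abs_of_pos (mul_pos hB hQ), abs_of_pos (pow_pos h1 2)]
  unfold P
  have f : ∀ y : ℝ, 0 < y → y ^ (-s) * y ^ (s - 1) = y⁻¹ := fun y hy => by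
    rw [← Real.rpow_add hy, show -s + (s - 1) = -1 by ring, Real.rpow_neg_one]
  have f1 := f _ hB
  have f2 := f _ hi
  have f3 : (R - x) ^ s = (R - x) ^ (s - 1) * (R - x) := by
    nth_rewrite 3 [← Real.rpow_one (R - x)]
    rw [← Real.rpow_add hQ]; congr 1; ring
  rw [inv_inv] at f2
  rw [f3]
  calc _ = (b - x) * (R - x) / (t - x) ^ 2 * (x ^ s * (t - R) ^ (-s) * (R - x) ^ (s - 1))
        * ((b - x) ^ (-s) * (b - x) ^ (s - 1)) * ((t - x)⁻¹ ^ (-s) * (t - x)⁻¹ ^ (s - 1)) := by ring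
    _ = _ := by rw [f1, f2]; field_simp

lemma P_int {s : ℝ} (hs1 : s < 1) {R x : ℝ} (hxR : x < R) {A B : ℝ} (hA : R ≤ A)
    (hB : A ≤ B) : IntervalIntegrable (P s R x) volume A B := by
  have h : IntervalIntegrable (P s R x) volume R B := by
    rw [intervalIntegrable_iff_integrableOn_Ioo_of_le (hA.trans hB)]
    refine Integrable.mono' ((integrableOn_sub_right_rpow (p := -s) (by linarith) B R).const_mul
      ((R - x) ^ s / (R - x))) (measurable_P s R x).aestronglyMeasurable ?_
    filter_upwards [ae_restrict_mem measurableSet_Ioo] with t ht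
    rw [Real.norm_of_nonneg (P_nonneg hxR ht.1.le)]
    unfold P
    have h1 : 0 < R - x := by linarith
    have h3 : 0 < t - R := by linarith [ht.1]
    rw [div_mul_eq_mul_div]
    apply div_le_div_of_nonneg_left _ h1 (by linarith)
    positivity
  exact h.mono_set (by rw [uIcc_of_le hB, uIcc_of_le (hA.trans hB)]; exact Icc_subset_Icc_left hA)

lemma G_formula {s : ℝ} {R b x : ℝ} (hb : R ≤ b) (hx : 0 < x)
    (hxR : x < R) : G s R b x = x ^ s * ∫ t in R..b, P s R x t := by
  rcases hb.eq_or_lt with h | h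
  · subst h; unfold G; simp
  · rw [G_formula_set h hx hxR, intervalIntegral.integral_of_le hb, integral_Ioc_eq_integral_Ioo]

lemma P_diff {s : ℝ} (hs0 : 0 < s) (hs1 : s < 1) {R x1 x2 t : ℝ} (h12 : x1 < x2) (h2R : x2 < R)
    (ht : R < t) : |P s R x1 t - P s R x2 t| ≤ (x2 - x1) / (R - x2) * P s R x2 t := by
  have hQ1 : 0 < R - x1 := by linarith
  have hQ2 : 0 < R - x2 := by linarith
  have hT1 : 0 < t - x1 := by linarith
  have hT2 : 0 < t - x2 := by linarith
  have hPn := P_nonneg (s := s) h2R ht.le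
  set A := (R - x1) / (R - x2) with hA
  set B := (t - x1) / (t - x2) with hB
  have hA1 : A - 1 = (x2 - x1) / (R - x2) := by rw [hA]; field_simp; ring
  have hB1 : B - 1 = (x2 - x1) / (t - x2) := by rw [hB]; field_simp; ring
  have hd : 0 < x2 - x1 := by linarith
  have hAB : B - 1 ≤ A - 1 := by
    rw [hA1, hB1]; exact div_le_div_of_nonneg_left hd.le hQ2 (by linarith)
  have hB0 : 1 < B := by have : 0 < B - 1 := by rw [hB1]; positivity
                         linarith
  have hA0 : 1 < A := by linarith
  have e : P s R x1 t = P s R x2 t * (A ^ s / B) := by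
    unfold P
    rw [hA, Real.div_rpow hQ1.le hQ2.le, hB]
    have := Real.rpow_pos_of_pos hQ2 s
    field_simp
  have h1 : 1 ≤ A ^ s := Real.one_le_rpow hA0.le hs0.le
  have h2 : A ^ s ≤ A := by
    calc A ^ s ≤ A ^ (1:ℝ) := Real.rpow_le_rpow_of_exponent_le hA0.le hs1.le
      _ = A := Real.rpow_one A
  have h3 : A ^ s / B ≤ A := (div_le_self (by positivity) hB0.le).trans h2
  have h4 : 2 - B ≤ A ^ s / B := by
    rw [le_div_iff₀ (by positivity)]
    nlinarith [sq_nonneg (B - 1)]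
  rw [e, ← hA1, show P s R x2 t * (A ^ s / B) - P s R x2 t = (A ^ s / B - 1) * P s R x2 t by ring,
    abs_mul, abs_of_nonneg hPn]
  apply mul_le_mul_of_nonneg_right _ hPn
  rw [abs_le]; constructor <;> linarith

noncomputable def I0 (s β : ℝ) : ℝ := ∫ τ in Ioi (1:ℝ), τ ^ (β - s - 1) * (τ - 1) ^ (-s)

lemma I0_int {s β : ℝ} (hs0 : 0 < s) (hs1 : s < 1) (hβ : β < 2 * s) :
    IntegrableOn (fun τ : ℝ => τ ^ (β - s - 1) * (τ - 1) ^ (-s)) (Ioi 1) := by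
  have hm : Measurable (fun τ : ℝ => τ ^ (β - s - 1) * (τ - 1) ^ (-s)) := by fun_prop
  rw [← Ioo_union_Ici_eq_Ioi (one_lt_two : (1:ℝ) < 2)]
  apply IntegrableOn.union
  · refine Integrable.mono' (integrableOn_sub_right_rpow (p := -s) (by linarith) 2 1)
      hm.aestronglyMeasurable ?_
    filter_upwards [ae_restrict_mem measurableSet_Ioo] with t ht
    have h1 : 0 ≤ (t - 1) ^ (-s) := Real.rpow_nonneg (by linarith [ht.1]) _
    have h2 : 0 ≤ t ^ (β - s - 1) := Real.rpow_nonneg (by linarith [ht.1]) _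
    rw [Real.norm_of_nonneg (mul_nonneg h2 h1)]
    exact mul_le_of_le_one_left h1 (Real.rpow_le_one_of_one_le_of_nonpos ht.1.le (by linarith))
  · rw [integrableOn_Ici_iff_integrableOn_Ioi]
    refine Integrable.mono' ((integrableOn_Ioi_rpow_of_lt (a := β - 2 * s - 1) (by linarith)
      (two_pos : (0:ℝ) < 2)).const_mul ((2⁻¹ : ℝ) ^ (-s))) hm.aestronglyMeasurable ?_
    filter_upwards [ae_restrict_mem measurableSet_Ioi] with t ht
    have ht' : 2 < t := ht
    have h1 : 0 ≤ (t - 1) ^ (-s) := Real.rpow_nonneg (by linarith) _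
    have h2 : 0 ≤ t ^ (β - s - 1) := Real.rpow_nonneg (by linarith) _
    rw [Real.norm_of_nonneg (mul_nonneg h2 h1)]
    have h3 : (t - 1) ^ (-s) ≤ (2⁻¹ * t) ^ (-s) :=
      Real.rpow_le_rpow_of_nonpos (by linarith) (by linarith) (by linarith)
    calc _ ≤ t ^ (β - s - 1) * (2⁻¹ * t) ^ (-s) := mul_le_mul_of_nonneg_left h3 h2
      _ = (2⁻¹ : ℝ) ^ (-s) * (t ^ (β - s - 1) * t ^ (-s)) := by
          rw [Real.mul_rpow (by norm_num) (by linarith)]; ring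
      _ = _ := by rw [← Real.rpow_add (by linarith)]; congr 2; ring

lemma I0_nonneg (s β : ℝ) : 0 ≤ I0 s β := by
  apply setIntegral_nonneg measurableSet_Ioi
  intro t ht
  have ht' : 1 < t := ht
  exact mul_nonneg (Real.rpow_nonneg (by linarith) _) (Real.rpow_nonneg (by linarith) _)

lemma J_eq {s β R : ℝ} (hs0 : 0 < s) (hs1 : s < 1) (hβ : β < 2 * s) (hR : 0 < R) :
    IntegrableOn (fun t : ℝ => t ^ (β - s - 1) * (t - R) ^ (-s)) (Ioi R) ∧
    ∫ t in Ioi R, t ^ (β - s - 1) * (t - R) ^ (-s) = R ^ (β - 2 * s) * I0 s β := by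
  have e : ∀ τ ∈ Ioi (1:ℝ), (R * τ) ^ (β - s - 1) * (R * τ - R) ^ (-s)
      = R ^ (β - 2 * s - 1) * (τ ^ (β - s - 1) * (τ - 1) ^ (-s)) := by
    intro τ hτ
    have hτ' : 1 < τ := hτ
    rw [show R * τ - R = R * (τ - 1) by ring, Real.mul_rpow hR.le (by linarith),
      Real.mul_rpow hR.le (by linarith), show β - 2 * s - 1 = (β - s - 1) + (-s) by ring,
      Real.rpow_add hR]
    ring
  constructor
  · have h := integrableOn_Ioi_comp_mul_left_iff
      (fun t : ℝ => t ^ (β - s - 1) * (t - R) ^ (-s)) 1 hR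
    rw [mul_one] at h
    rw [← h]
    exact IntegrableOn.congr_fun ((I0_int hs0 hs1 hβ).const_mul _) (fun τ hτ => (e τ hτ).symm)
      measurableSet_Ioi
  · have h := integral_comp_mul_left_Ioi
      (fun t : ℝ => t ^ (β - s - 1) * (t - R) ^ (-s)) 1 hR
    rw [mul_one, setIntegral_congr_fun measurableSet_Ioi e, integral_const_mul, smul_eq_mul,
      eq_inv_mul_iff_mul_eq₀ hR.ne'] at h
    rw [← h]
    unfold I0
    rw [← mul_assoc]
    congr 1
    nth_rewrite 1 [← Real.rpow_one R]
    rw [← Real.rpow_add hR]; congr 1; ring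

lemma P_weighted {s β R x A : ℝ} (hs0 : 0 < s) (hs1 : s < 1) (hβ : β < 2 * s) (hx : 0 < x)
    (hxR : 2 * x ≤ R) (hA : R ≤ A) :
    IntervalIntegrable (fun t => t ^ (β - s) * P s R x t) volume R A ∧
    ∫ t in R..A, t ^ (β - s) * P s R x t ≤ 2 * R ^ (β - s) * I0 s β := by
  have hR : 0 < R := by linarith
  have hxR' : x < R := by linarith
  obtain ⟨i, v⟩ := J_eq hs0 hs1 hβ hR
  have hle : ∀ t ∈ Ioi R, t ^ (β - s) * P s R x t
      ≤ 2 * R ^ s * (t ^ (β - s - 1) * (t - R) ^ (-s)) := by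
    intro t ht
    have ht' : R < t := ht
    have ht0 : 0 < t := hR.trans ht'
    have htx : 0 < t - x := by linarith
    have h1 : (R - x) ^ s ≤ R ^ s := Real.rpow_le_rpow (by linarith) (by linarith) hs0.le
    have h2 : t / (t - x) ≤ 2 := by rw [div_le_iff₀ htx]; linarith
    have h3 : 0 ≤ (t - R) ^ (-s) := Real.rpow_nonneg (by linarith) _
    have h4 : t ^ (β - s) = t ^ (β - s - 1) * t := by
      nth_rewrite 3 [← Real.rpow_one t]
      rw [← Real.rpow_add ht0]; congr 1; ring
    have h5 : 0 ≤ t ^ (β - s - 1) := Real.rpow_nonneg ht0.le _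
    have h6 : 0 ≤ t / (t - x) := by positivity
    unfold P
    rw [h4]
    calc t ^ (β - s - 1) * t * ((R - x) ^ s * (t - R) ^ (-s) / (t - x))
        = ((t / (t - x)) * (R - x) ^ s) * (t ^ (β - s - 1) * (t - R) ^ (-s)) := by ring
      _ ≤ _ := mul_le_mul_of_nonneg_right
          (mul_le_mul h2 h1 (Real.rpow_nonneg (by linarith) _) (by norm_num)) (mul_nonneg h5 h3)
  have i2 : IntegrableOn (fun t => t ^ (β - s) * P s R x t) (Ioi R) := by
    refine Integrable.mono' (i.const_mul (2 * R ^ s)) ?_ ?_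
    · apply Measurable.aestronglyMeasurable
      have := measurable_P s R x
      fun_prop
    · filter_upwards [ae_restrict_mem measurableSet_Ioi] with t ht
      have ht' : R < t := ht
      rw [Real.norm_of_nonneg (mul_nonneg (Real.rpow_nonneg (by linarith) _) (P_nonneg hxR' ht'.le))]
      exact hle t ht
  constructor
  · rw [intervalIntegrable_iff_integrableOn_Ioc_of_le hA]
    exact i2.mono_set Ioc_subset_Ioi_self
  · rw [intervalIntegral.integral_of_le hA]
    calc _ ≤ ∫ t in Ioi R, t ^ (β - s) * P s R x t := by
          apply setIntegral_mono_set i2 _ (Ioc_subset_Ioi_self.eventuallyLE)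
          filter_upwards [ae_restrict_mem measurableSet_Ioi] with t ht
          have ht' : R < t := ht
          exact mul_nonneg (Real.rpow_nonneg (by linarith) _) (P_nonneg hxR' ht'.le)
      _ ≤ ∫ t in Ioi R, 2 * R ^ s * (t ^ (β - s - 1) * (t - R) ^ (-s)) :=
          setIntegral_mono_on i2 (i.const_mul _) measurableSet_Ioi hle
      _ = _ := by
          rw [integral_const_mul, v, show β - s = s + (β - 2 * s) by ring, Real.rpow_add hR]
          ring

noncomputable def hsum (s R : ℝ) (N : ℕ) (t g : ℕ → ℝ) (z : ℝ) : ℝ :=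
  ∑ i ∈ Finset.range N, g i * (c0 s)⁻¹ * (G s R (t (i + 1)) z - G s R (t i) z)

lemma hsum_diff {s β R x1 x2 c : ℝ} (hs0 : 0 < s) (hs1 : s < 1) (hβs : s ≤ β) (hβ : β < 2 * s)
    (hx : 0 < x1) (h12 : x1 < x2) (hxR : 2 * x2 ≤ R) (hc : 0 ≤ c)
    {N : ℕ} {t g : ℕ → ℝ} (ht : Monotone t) (ht0 : t 0 = R)
    (hg : ∀ i, i < N → |g i| ≤ c * t i ^ (β - s)) :
    |hsum s R N t g x1 / x1 ^ s - hsum s R N t g x2 / x2 ^ s|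
      ≤ (c0 s)⁻¹ * ((x2 - x1) / (R - x2)) * c * (2 * R ^ (β - s) * I0 s β) := by
  have hc0 := c0_pos hs0 hs1
  have hx2 : 0 < x2 := hx.trans h12
  have hR : 0 < R := by linarith
  have htR : ∀ i, R ≤ t i := fun i => ht0 ▸ ht (Nat.zero_le i)
  have hti : ∀ i, t i ≤ t (i + 1) := fun i => ht (Nat.le_succ i)
  have hval : ∀ x, 0 < x → x < R → hsum s R N t g x / x ^ s
      = ∑ i ∈ Finset.range N, g i * (c0 s)⁻¹ * ∫ τ in t i..t (i + 1), P s R x τ := by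
    intro x hx hxR
    have hxs := Real.rpow_pos_of_pos hx s
    unfold hsum
    rw [Finset.sum_div]
    apply Finset.sum_congr rfl
    intro i _
    rw [G_formula (htR _) hx hxR, G_formula (htR _) hx hxR,
      ← intervalIntegral.integral_interval_sub_left (P_int hs1 hxR le_rfl (htR (i + 1)))
        (P_int hs1 hxR le_rfl (htR i))]
    field_simp
  rw [hval x1 hx (by linarith), hval x2 hx2 (by linarith), ← Finset.sum_sub_distrib]
  set κ := (x2 - x1) / (R - x2) with hκ
  have hκ0 : 0 ≤ κ := div_nonneg (by linarith) (by linarith)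
  have hW := fun A (hA : R ≤ A) => P_weighted hs0 hs1 hβ hx2 hxR hA
  have hWi : ∀ i, IntervalIntegrable (fun t => t ^ (β - s) * P s R x2 t) volume (t i) (t (i + 1)) := by
    intro i
    refine (hW _ (htR (i + 1))).1.mono_set ?_
    rw [uIcc_of_le (hti i), uIcc_of_le (htR _)]
    exact Icc_subset_Icc_left (htR i)
  have hterm : ∀ i ∈ Finset.range N,
      |g i * (c0 s)⁻¹ * (∫ τ in t i..t (i + 1), P s R x1 τ)
        - g i * (c0 s)⁻¹ * (∫ τ in t i..t (i + 1), P s R x2 τ)|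
      ≤ (c0 s)⁻¹ * κ * c * ∫ τ in t i..t (i + 1), τ ^ (β - s) * P s R x2 τ := by
    intro i hi
    have hP1 := P_int hs1 (show x1 < R by linarith) (htR i) (hti i)
    have hP2 := P_int hs1 (show x2 < R by linarith) (htR i) (hti i)
    rw [← mul_sub, ← intervalIntegral.integral_sub hP1 hP2, abs_mul, abs_mul,
      abs_of_pos (inv_pos.2 hc0)]
    have b1 : |∫ τ in t i..t (i + 1), (P s R x1 τ - P s R x2 τ)|
        ≤ κ * ∫ τ in t i..t (i + 1), P s R x2 τ := by
      rw [← intervalIntegral.integral_const_mul]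
      refine (intervalIntegral.abs_integral_le_integral_abs (hti i)).trans ?_
      refine intervalIntegral.integral_mono_on_of_le_Ioo (hti i) (hP1.sub hP2).abs (hP2.const_mul κ) ?_
      intro τ hτ
      exact P_diff hs0 hs1 h12 (by linarith) ((htR i).trans_lt hτ.1)
    have b2 : |g i| * ∫ τ in t i..t (i + 1), P s R x2 τ
        ≤ c * ∫ τ in t i..t (i + 1), τ ^ (β - s) * P s R x2 τ := by
      rw [← intervalIntegral.integral_const_mul, ← intervalIntegral.integral_const_mul]
      refine intervalIntegral.integral_mono_on_of_le_Ioo (hti i) (hP2.const_mul _)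
        ((hWi i).const_mul c) ?_
      intro τ hτ
      have hp : 0 ≤ P s R x2 τ := P_nonneg (by linarith) ((htR i).trans hτ.1.le)
      rw [← mul_assoc]
      apply mul_le_mul_of_nonneg_right _ hp
      refine (hg i (Finset.mem_range.1 hi)).trans (mul_le_mul_of_nonneg_left ?_ hc)
      exact Real.rpow_le_rpow (hR.le.trans (htR i)) hτ.1.le (by linarith)
    calc |g i| * (c0 s)⁻¹ * |∫ τ in t i..t (i + 1), (P s R x1 τ - P s R x2 τ)|
        ≤ |g i| * (c0 s)⁻¹ * (κ * ∫ τ in t i..t (i + 1), P s R x2 τ) :=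
          mul_le_mul_of_nonneg_left b1 (by positivity)
      _ = (c0 s)⁻¹ * κ * (|g i| * ∫ τ in t i..t (i + 1), P s R x2 τ) := by ring
      _ ≤ (c0 s)⁻¹ * κ * (c * ∫ τ in t i..t (i + 1), τ ^ (β - s) * P s R x2 τ) :=
          mul_le_mul_of_nonneg_left b2 (by positivity)
      _ = _ := by ring
  refine (Finset.abs_sum_le_sum_abs _ _).trans ((Finset.sum_le_sum hterm).trans ?_)
  rw [← Finset.mul_sum, intervalIntegral.sum_integral_adjacent_intervals (fun i _ => hWi i), ht0]
  exact mul_le_mul_of_nonneg_left (hW _ (htR N)).2 (by positivity)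

end Stmt8Aux

namespace Stmt8Aux
open MeasureTheory Set Filter Topology

lemma sol_zero (s x : ℝ) {f : ℝ → ℝ} (hf : ∀ z, f z = 0) : Sol s f x := by
  have : D s f x = fun _ => 0 := by
    funext r; simp [D, hf]
  constructor
  · rw [this]; exact integrableOn_zero
  · rw [this]; simp

lemma sol_hsum {s : ℝ} (hs0 : 0 < s) (hs1 : s < 1) {R x : ℝ} (hx : 0 < x) (hxR : x < R)
    {N : ℕ} {t g : ℕ → ℝ} (htR : ∀ i, R ≤ t i) : Sol s (hsum s R N t g) x := by
  have h1 : ∀ i, Sol s (G s R (t i)) x := by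
    intro i
    rcases (htR i).eq_or_lt with h | h
    · apply sol_zero
      intro z; rw [← h]; unfold G; simp
    · exact sol_G hs0 hs1 h hx hxR
  exact Sol.sum N (fun i _ => Sol.const_mul (Sol.sub (h1 (i + 1)) (h1 i)) _)

lemma hsum_cont {s : ℝ} (hs0 : 0 < s) (hs1 : s < 1) {R : ℝ}
    {N : ℕ} {t g : ℕ → ℝ} : ContinuousOn (hsum s R N t g) (Icc 0 R) := by
  unfold hsum
  refine continuousOn_finsetSum _ fun i _ => ?_
  exact continuousOn_const.mul ((continuousOn_G hs0 hs1).sub (continuousOn_G hs0 hs1))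

lemma hsum_nonpos {s : ℝ} (hs0 : 0 < s) {R z : ℝ} (hz : z ≤ 0)
    {N : ℕ} {t g : ℕ → ℝ} : hsum s R N t g z = 0 := by
  unfold hsum
  simp [G_of_nonpos hs0 hz]

lemma hsum_ge {s : ℝ} (hs1 : s < 1) {R z : ℝ}
    {N : ℕ} {t g : ℕ → ℝ} (ht : Monotone t) (hz : t N ≤ z) : hsum s R N t g z = 0 := by
  unfold hsum
  apply Finset.sum_eq_zero
  intro i hi
  have hi' := Finset.mem_range.1 hi
  rw [G_of_ge hs1 ((ht (show i ≤ N by omega)).trans hz),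
    G_of_ge hs1 ((ht (show i + 1 ≤ N by omega)).trans hz)]
  simp

lemma hsum_mem {s : ℝ} (hs0 : 0 < s) (hs1 : s < 1) {R z : ℝ} (hR : 0 < R) (hRz : R ≤ z)
    {N : ℕ} {t g : ℕ → ℝ} (ht : Monotone t) {i : ℕ} (hi : i < N) (h1 : t i ≤ z)
    (h2 : z < t (i + 1)) : hsum s R N t g z = g i * z ^ s := by
  have hc0 := c0_pos hs0 hs1
  unfold hsum
  rw [Finset.sum_eq_single_of_mem i (Finset.mem_range.2 hi)]
  · rw [G_of_ge hs1 h1, G_of_mem hs1 hR hRz h2]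
    field_simp
    ring
  · intro j _ hj
    rcases lt_or_gt_of_ne hj with h | h
    · rw [G_of_ge hs1 ((ht h.le).trans h1), G_of_ge hs1 ((ht (show j + 1 ≤ i by omega)).trans h1)]
      simp
    · rw [G_of_mem hs1 hR hRz (h2.trans_le (ht (show i + 1 ≤ j by omega))),
        G_of_mem hs1 hR hRz (h2.trans_le (ht (show i + 1 ≤ j + 1 by omega)))]
      simp

lemma approx {s β c R ε : ℝ} (hs0 : 0 < s) (hs1 : s < 1) (hβs : s ≤ β) (hβ : β < 2 * s)
    (hc : 0 ≤ c) (hR : 1 ≤ R) (hε : 0 < ε) {u : ℝ → ℝ} (hu : Continuous u)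
    (hz : ∀ x, x ≤ 0 → u x = 0) (hg : ∀ z, 1 ≤ z → |u z| ≤ c * z ^ β)
    (hsol : ∀ x, 0 < x → Sol s u x) :
    ∃ (N : ℕ) (t g : ℕ → ℝ), Monotone t ∧ t 0 = R ∧ (∀ i, i < N → |g i| ≤ c * t i ^ (β - s)) ∧
      ∀ x ∈ Icc 0 R, |u x - hsum s R N t g x| ≤ ε := by
  have hR0 : 0 < R := by linarith
  have hβ0 : 0 < β := by linarith
  obtain ⟨A, hA2, htail⟩ : ∃ A, 2 * R ≤ A ∧
      c * (2 ^ β * ((A - R) ^ (β - 2 * s) / (2 * s - β))) ≤ ε * (R ^ (-(2 * s)) / (2 * s)) := by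
    have h1 : Tendsto (fun A : ℝ => (A - R) ^ (-(2 * s - β))) atTop (𝓝 0) :=
      (tendsto_rpow_neg_atTop (by linarith)).comp (tendsto_atTop_add_const_right _ (-R) tendsto_id)
    have h2 : Tendsto (fun A : ℝ => c * (2 ^ β * ((A - R) ^ (-(2 * s - β)) / (2 * s - β)))) atTop
        (𝓝 (c * (2 ^ β * (0 / (2 * s - β))))) :=
      ((h1.div_const _).const_mul _).const_mul _
    rw [zero_div, mul_zero, mul_zero] at h2
    have h3 : 0 < ε * (R ^ (-(2 * s)) / (2 * s)) := by positivity
    obtain ⟨A, hA, hA'⟩ := ((h2.eventually (gt_mem_nhds h3)).and (eventually_ge_atTop (2 * R))).exists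
    refine ⟨A, hA', ?_⟩
    rw [show β - 2 * s = -(2 * s - β) by ring]
    exact hA.le
  have hAR : 0 < A - R := by linarith
  have hA0 : 0 < A := by linarith
  have hAs : 0 < A ^ s := Real.rpow_pos_of_pos hA0 s
  set q : ℝ → ℝ := fun z => u z / z ^ s with hq
  have hqc : ContinuousOn q (Icc R A) := by
    intro z hz
    have hz0 : 0 < z := hR0.trans_le hz.1
    apply ContinuousAt.continuousWithinAt
    exact hu.continuousAt.div (Real.continuousAt_rpow_const _ _ (Or.inr hs0.le))
      (Real.rpow_pos_of_pos hz0 s).ne'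
  have huc := isCompact_Icc.uniformContinuousOn_of_continuous hqc
  rw [Metric.uniformContinuousOn_iff] at huc
  obtain ⟨δ, hδ, hunif⟩ := huc (ε / A ^ s) (by positivity)
  obtain ⟨n, hn⟩ := exists_nat_gt ((A - R) / δ)
  set N := n + 1 with hN
  have hN0 : (0:ℝ) < N := by rw [hN]; push_cast; positivity
  have hNδ : (A - R) / N < δ := by
    rw [div_lt_iff₀ hN0]
    rw [div_lt_iff₀ hδ] at hn
    rw [hN]; push_cast; nlinarith
  set d := (A - R) / N with hd
  have hd0 : 0 < d := by positivity
  set t : ℕ → ℝ := fun i => R + i * d with ht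
  have htm : Monotone t := by
    intro i j hij
    simp only [ht]
    have : (i:ℝ) ≤ j := by exact_mod_cast hij
    nlinarith
  have ht0 : t 0 = R := by simp [ht]
  have htN : t N = A := by simp only [ht, hd]; field_simp; ring
  have htR : ∀ i, R ≤ t i := fun i => ht0 ▸ htm (Nat.zero_le i)
  set g : ℕ → ℝ := fun i => q (t i) with hgdef
  have happ : ∀ z, R ≤ z → z < A → |u z - hsum s R N t g z| ≤ ε := by
    intro z hRz hzA
    have hz0 : 0 < z := hR0.trans_le hRz
    set i := ⌊(z - R) / d⌋₊ with hi
    have k0 : 0 ≤ (z - R) / d := div_nonneg (by linarith) hd0.le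
    have k1 : (i:ℝ) * d ≤ z - R := (le_div_iff₀ hd0).1 (Nat.floor_le k0)
    have k2 : z - R < ((i:ℝ) + 1) * d := (div_lt_iff₀ hd0).1 (Nat.lt_floor_add_one _)
    have h1 : t i ≤ z := by simp only [ht]; linarith
    have h2 : z < t (i + 1) := by simp only [ht]; push_cast; linarith
    have hiN : i < N := by
      by_contra h
      have := htm (not_lt.1 h)
      linarith
    rw [hsum_mem hs0 hs1 hR0 hRz htm hiN h1 h2]
    have h3 := hunif z ⟨hRz, hzA.le⟩ (t i) ⟨htR i, by linarith⟩ (by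
      rw [Real.dist_eq, abs_of_nonneg (by linarith)]
      have : t (i + 1) = t i + d := by simp only [ht]; push_cast; ring
      linarith)
    rw [Real.dist_eq] at h3
    have hzs := Real.rpow_pos_of_pos hz0 s
    have e : u z - g i * z ^ s = (q z - q (t i)) * z ^ s := by
      simp only [hgdef, hq]; field_simp
    rw [e, abs_mul, abs_of_pos hzs]
    calc _ ≤ ε / A ^ s * A ^ s :=
          mul_le_mul h3.le (Real.rpow_le_rpow hz0.le hzA.le hs0.le) hzs.le (by positivity)
      _ = ε := by field_simp
  refine ⟨N, t, g, htm, ht0, ?_, ?_⟩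
  · intro i _
    have hti : 0 < t i := hR0.trans_le (htR i)
    have := hg (t i) (hR.trans (htR i))
    simp only [hgdef, hq]
    rw [abs_div, abs_of_pos (Real.rpow_pos_of_pos hti s), div_le_iff₀ (Real.rpow_pos_of_pos hti s),
      mul_assoc, ← Real.rpow_add hti]
    simpa using this
  · have m1 := max_principle (w := fun z => u z - hsum s R N t g z) hs0 hβ0 hβ hc hR0 hA2 hε htail
      (hu.continuousOn.sub (hsum_cont hs0 hs1))
      (fun z hz0 => by rw [hz z hz0, hsum_nonpos hs0 hz0, sub_zero])
      (fun z h1 h2 => (abs_le.1 (happ z h1 h2)).2)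
      (fun z h1 => by
        rw [hsum_ge hs1 htm (htN.trans_le h1), sub_zero]
        exact (le_abs_self _).trans (hg z (by linarith)))
      (fun x hx hxR => (hsol x hx).sub (sol_hsum hs0 hs1 hx hxR htR))
    have m2 := max_principle (w := fun z => hsum s R N t g z - u z) hs0 hβ0 hβ hc hR0 hA2 hε htail
      ((hsum_cont hs0 hs1).sub hu.continuousOn)
      (fun z hz0 => by rw [hz z hz0, hsum_nonpos hs0 hz0, sub_zero])
      (fun z h1 h2 => by have := (abs_le.1 (happ z h1 h2)).1; linarith)
      (fun z h1 => by
        rw [hsum_ge hs1 htm (htN.trans_le h1), zero_sub]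
        exact (neg_le_abs _).trans (hg z (by linarith)))
      (fun x hx hxR => (sol_hsum hs0 hs1 hx hxR htR).sub (hsol x hx))
    intro x hx
    have a1 := m1 x hx
    have a2 := m2 x hx
    rw [abs_le]; constructor <;> linarith

lemma quot_eq {s β c : ℝ} (hs0 : 0 < s) (hs1 : s < 1) (hβs : s ≤ β) (hβ : β < 2 * s)
    (hc : 0 ≤ c) {u : ℝ → ℝ} (hu : Continuous u)
    (hz : ∀ x, x ≤ 0 → u x = 0) (hg : ∀ z, 1 ≤ z → |u z| ≤ c * z ^ β)
    (hsol : ∀ x, 0 < x → Sol s u x) {x1 x2 : ℝ} (hx1 : 0 < x1) (h12 : x1 < x2) :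
    u x1 / x1 ^ s = u x2 / x2 ^ s := by
  have hx2 : 0 < x2 := hx1.trans h12
  have p1 := Real.rpow_pos_of_pos hx1 s
  have p2 := Real.rpow_pos_of_pos hx2 s
  have hc0 := c0_pos hs0 hs1
  have hI := I0_nonneg s β
  have h1 : ∀ R, max 1 (2 * x2) ≤ R → |u x1 / x1 ^ s - u x2 / x2 ^ s|
      ≤ (c0 s)⁻¹ * ((x2 - x1) / (R - x2)) * c * (2 * R ^ (β - s) * I0 s β) := by
    intro R hR
    have hR1 : 1 ≤ R := (le_max_left _ _).trans hR
    have hR2 : 2 * x2 ≤ R := (le_max_right _ _).trans hR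
    apply le_of_forall_pos_le_add
    intro η hη
    set ε := η / ((x1 ^ s)⁻¹ + (x2 ^ s)⁻¹) with hεd
    have hε : 0 < ε := by positivity
    obtain ⟨N, t, g, htm, ht0, hgi, ha⟩ := approx hs0 hs1 hβs hβ hc hR1 hε hu hz hg hsol
    have hd := hsum_diff hs0 hs1 hβs hβ hx1 h12 hR2 hc htm ht0 hgi
    have a1 := ha x1 ⟨hx1.le, by linarith⟩
    have a2 := ha x2 ⟨hx2.le, by linarith⟩
    set h := hsum s R N t g
    have b : ∀ x, 0 < x ^ s → |u x - h x| ≤ ε → |u x / x ^ s - h x / x ^ s| ≤ ε * (x ^ s)⁻¹ := by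
      intro x hx hh
      rw [← sub_div, abs_div, abs_of_pos hx, div_eq_mul_inv]
      exact mul_le_mul_of_nonneg_right hh (inv_pos.2 hx).le
    have b1 := abs_le.1 (b x1 p1 a1)
    have b2 := abs_le.1 (b x2 p2 a2)
    have hd' := abs_le.1 hd
    have hsum : ε * (x1 ^ s)⁻¹ + ε * (x2 ^ s)⁻¹ = η := by
      rw [← mul_add, hεd]; field_simp
    rw [abs_le]
    constructor <;> linarith [b1.1, b1.2, b2.1, b2.2, hd'.1, hd'.2]
  have h2 : ∀ᶠ R in atTop, |u x1 / x1 ^ s - u x2 / x2 ^ s|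
      ≤ ((c0 s)⁻¹ * (x2 - x1) * c * 4 * I0 s β) * R ^ (-(1 + s - β)) := by
    filter_upwards [eventually_ge_atTop (max 1 (2 * x2))] with R hR
    have hR1 : 1 ≤ R := (le_max_left _ _).trans hR
    have hR2 : 2 * x2 ≤ R := (le_max_right _ _).trans hR
    have hR0 : 0 < R := by linarith
    have hd : 0 < x2 - x1 := by linarith
    refine (h1 R hR).trans ?_
    have k1 : (x2 - x1) / (R - x2) ≤ 2 * (x2 - x1) / R := by
      rw [div_le_div_iff₀ (by linarith) hR0]; nlinarith
    have k2 : R ^ (-(1 + s - β)) = R ^ (β - s) / R := by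
      rw [show -(1 + s - β) = (β - s) - 1 by ring, Real.rpow_sub_one hR0.ne']
    rw [k2]
    have k3 : 0 ≤ 2 * R ^ (β - s) * I0 s β := by positivity
    calc _ ≤ (c0 s)⁻¹ * (2 * (x2 - x1) / R) * c * (2 * R ^ (β - s) * I0 s β) := by gcongr
      _ = _ := by ring
  have h3 : Tendsto (fun R : ℝ => ((c0 s)⁻¹ * (x2 - x1) * c * 4 * I0 s β) * R ^ (-(1 + s - β)))
      atTop (𝓝 0) := by
    have := (tendsto_rpow_neg_atTop (show 0 < 1 + s - β by linarith)).const_mul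
      ((c0 s)⁻¹ * (x2 - x1) * c * 4 * I0 s β)
    rwa [mul_zero] at this
  have h4 := ge_of_tendsto h3 h2
  have h5 := abs_eq_zero.1 (le_antisymm h4 (abs_nonneg _))
  linarith

end Stmt8Aux

open MeasureTheory

/-- 1D Liouville theorem with subcritical growth: if `u ∈ C(ℝ)` satisfies `(-Δ)^s u = 0`
pointwise on `(0,∞)` (second-difference form), `u ≡ 0` on `(-∞,0]`, and
`|u(x)| ≤ C(1+|x|^β)` with `β < 2s`, then `u(x) = K (x_+)^s` for some constant `K`. -/
theorem stmt8 (s : ℝ) (hs0 : 0 < s) (hs1 : s < 1)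
    (u : ℝ → ℝ) (hu : Continuous u)
    (heq : ∀ x : ℝ, 0 < x →
      Integrable (fun r : ℝ => (u (x + r) + u (x - r) - 2 * u x) / |r| ^ (1 + 2 * s)) ∧
        ∫ r : ℝ, (u (x + r) + u (x - r) - 2 * u x) / |r| ^ (1 + 2 * s) = 0)
    (hzero : ∀ x : ℝ, x ≤ 0 → u x = 0)
    (C β : ℝ) (hβ : β < 2 * s)
    (hgrowth : ∀ x : ℝ, |u x| ≤ C * (1 + |x| ^ β)) :
    ∃ K : ℝ, ∀ x : ℝ, u x = K * (max x 0) ^ s := by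
  have hsol : ∀ x, 0 < x → Stmt8Aux.Sol s u x := fun x hx =>
    Stmt8Aux.sol_of_full (heq x hx).1 (heq x hx).2
  have hg : ∀ z, 1 ≤ z → |u z| ≤ (2 * |C|) * z ^ (max β s) := by
    intro z hz
    have h1 : z ^ β ≤ z ^ (max β s) := Real.rpow_le_rpow_of_exponent_le hz (le_max_left _ _)
    have h2 : 1 ≤ z ^ (max β s) := Real.one_le_rpow hz (hs0.le.trans (le_max_right _ _))
    have h3 := hgrowth z
    rw [abs_of_nonneg (show (0:ℝ) ≤ z by linarith)] at h3
    have h4 : 0 ≤ z ^ β := Real.rpow_nonneg (by linarith) _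
    calc |u z| ≤ C * (1 + z ^ β) := h3
      _ ≤ |C| * (1 + z ^ β) := mul_le_mul_of_nonneg_right (le_abs_self C) (by linarith)
      _ ≤ |C| * (2 * z ^ (max β s)) := mul_le_mul_of_nonneg_left (by linarith) (abs_nonneg C)
      _ = _ := by ring
  have hq := fun (x1 x2 : ℝ) (hx1 : 0 < x1) (h12 : x1 < x2) =>
    Stmt8Aux.quot_eq hs0 hs1 (le_max_right β s) (max_lt hβ (by linarith))
      (by positivity : 0 ≤ 2 * |C|) hu hzero hg hsol hx1 h12
  refine ⟨u 1, fun x => ?_⟩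
  rcases le_or_gt x 0 with hx | hx
  · rw [hzero x hx, max_eq_right hx, Real.zero_rpow hs0.ne', mul_zero]
  · rw [max_eq_left hx.le]
    have p := Real.rpow_pos_of_pos hx s
    have : u x / x ^ s = u 1 := by
      rcases lt_trichotomy x 1 with h | h | h
      · rw [hq x 1 hx h]; simp
      · subst h; simp
      · rw [← hq 1 x one_pos h]; simp
    rw [← this]; field_simp
end
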